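/- For every n ≥ 1, the reduced type-B Birman–Murakami–Wenzl algebra BB_n(R) is generated as an R-module by at most 2^n·(2n−1)!! elements; these spanning elements can be taken of the form α·β·γ, where α is a product of elements Y'_i, γ is a product of elements (Y'_i)⁻¹, α and γ together contain at most n factors, and β lies in the R-subalgebra of BB_n(R) generated by X_1, …, X_{n−1}. In particular, if R is a field then dim_R BB_n(R) ≤ 2^n·(2n−1)!!. -/

import Mathlib

namespace BMWB

inductive Gen (n : ℕ) : Type
  | X : Fin (n - 1) → Gen n
  | Xinv : Fin (n - 1) → Gen n
  | Y : 0 < n → Gen n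
  | Yinv : 0 < n → Gen n

variable (R : Type) [CommRing R]

def fX {n : ℕ} (i : Fin (n - 1)) : FreeAlgebra R (Gen n) := FreeAlgebra.ι R (Gen.X i)
def fXinv {n : ℕ} (i : Fin (n - 1)) : FreeAlgebra R (Gen n) := FreeAlgebra.ι R (Gen.Xinv i)
def fY {n : ℕ} (h : 0 < n) : FreeAlgebra R (Gen n) := FreeAlgebra.ι R (Gen.Y h)
def fYinv {n : ℕ} (h : 0 < n) : FreeAlgebra R (Gen n) := FreeAlgebra.ι R (Gen.Yinv h)
def fe {n : ℕ} (deli : R) (i : Fin (n - 1)) : FreeAlgebra R (Gen n) :=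
  1 - deli • (fX R i - fXinv R i)

variable (lam lami deli q0 q1 A : R) (n : ℕ)

/-- The defining relations of the reduced Birman-Murakami-Wenzl algebra of Coxeter type B. -/
inductive Rel : FreeAlgebra R (Gen n) → FreeAlgebra R (Gen n) → Prop
  | XXinv (i : Fin (n - 1)) : Rel (fX R i * fXinv R i) 1
  | XinvX (i : Fin (n - 1)) : Rel (fXinv R i * fX R i) 1
  | YYinv (h : 0 < n) : Rel (fY R h * fYinv R h) 1
  | YinvY (h : 0 < n) : Rel (fYinv R h * fY R h) 1
  | comm (i j : Fin (n - 1)) (h : (j : ℕ) + 1 < (i : ℕ)) :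
      Rel (fX R i * fX R j) (fX R j * fX R i)
  | braid (i j : Fin (n - 1)) (h : (i : ℕ) + 1 = (j : ℕ)) :
      Rel (fX R i * fX R j * fX R i) (fX R j * fX R i * fX R j)
  | Xe (i : Fin (n - 1)) : Rel (fX R i * fe R deli i) (lam • fe R deli i)
  | eX (i : Fin (n - 1)) : Rel (fe R deli i * fX R i) (lam • fe R deli i)
  | eXe (i j : Fin (n - 1)) (h : (j : ℕ) + 1 = (i : ℕ)) :
      Rel (fe R deli i * fX R j * fe R deli i) (lami • fe R deli i)
  | eXinve (i j : Fin (n - 1)) (h : (j : ℕ) + 1 = (i : ℕ)) :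
      Rel (fe R deli i * fXinv R j * fe R deli i) (lam • fe R deli i)
  | bYXYX (h : 0 < n) (i : Fin (n - 1)) (hi : (i : ℕ) = 0) :
      Rel (fX R i * fY R h * fX R i * fY R h) (fY R h * fX R i * fY R h * fX R i)
  | Ysq (h : 0 < n) : Rel (fY R h * fY R h) (q1 • fY R h + q0 • (1 : FreeAlgebra R (Gen n)))
  | YXYe (h : 0 < n) (i : Fin (n - 1)) (hi : (i : ℕ) = 0) :
      Rel (fY R h * fX R i * fY R h * fe R deli i) (fe R deli i)
  | Ycomm (h : 0 < n) (i : Fin (n - 1)) (hi : 0 < (i : ℕ)) :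
      Rel (fY R h * fX R i) (fX R i * fY R h)
  | eYe (h : 0 < n) (i : Fin (n - 1)) (hi : (i : ℕ) = 0) :
      Rel (fe R deli i * fY R h * fe R deli i) (A • fe R deli i)

/-- The reduced Birman-Murakami-Wenzl algebra of Coxeter type B, `BB_n(R)`,
presented by generators and relations. -/
abbrev BB : Type := RingQuot (Rel R lam lami deli q0 q1 A n)

noncomputable def mk : FreeAlgebra R (Gen n) →ₐ[R] BB R lam lami deli q0 q1 A n :=
  RingQuot.mkAlgHom R (Rel R lam lami deli q0 q1 A n)

/-- The generator `Y` (junk value `1` if `n = 0`). -/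
noncomputable def YY : BB R lam lami deli q0 q1 A n :=
  if h : 0 < n then mk R lam lami deli q0 q1 A n (fY R h) else 1

/-- The inverse of the generator `Y`. -/
noncomputable def YYi : BB R lam lami deli q0 q1 A n :=
  if h : 0 < n then mk R lam lami deli q0 q1 A n (fYinv R h) else 1

/-- The generator `X_i`, `1 ≤ i ≤ n-1` (junk value `1` out of range). -/
noncomputable def XX (i : ℕ) : BB R lam lami deli q0 q1 A n :=
  if h : i - 1 < n - 1 then mk R lam lami deli q0 q1 A n (fX R ⟨i - 1, h⟩) else 1

/-- The inverse `X_i⁻¹`. -/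
noncomputable def XXi (i : ℕ) : BB R lam lami deli q0 q1 A n :=
  if h : i - 1 < n - 1 then mk R lam lami deli q0 q1 A n (fXinv R ⟨i - 1, h⟩) else 1

/-- The element `e_i := 1 - δ⁻¹ (X_i - X_i⁻¹)`. -/
noncomputable def ee (i : ℕ) : BB R lam lami deli q0 q1 A n :=
  1 - deli • (XX R lam lami deli q0 q1 A n i - XXi R lam lami deli q0 q1 A n i)

/-- `Y_i := X_{i-1} ⋯ X_1 Y X_1⁻¹ ⋯ X_{i-1}⁻¹`. -/
noncomputable def Yn : ℕ → BB R lam lami deli q0 q1 A n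
  | 0 => 1
  | 1 => YY R lam lami deli q0 q1 A n
  | (k + 2) => XX R lam lami deli q0 q1 A n (k + 1) * Yn (k + 1) * XXi R lam lami deli q0 q1 A n (k + 1)

/-- `Y'_i := X_{i-1} ⋯ X_1 Y X_1 ⋯ X_{i-1}`. -/
noncomputable def Yp : ℕ → BB R lam lami deli q0 q1 A n
  | 0 => 1
  | 1 => YY R lam lami deli q0 q1 A n
  | (k + 2) => XX R lam lami deli q0 q1 A n (k + 1) * Yp (k + 1) * XX R lam lami deli q0 q1 A n (k + 1)

/-- The inverse of `Y'_i`. -/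
noncomputable def Ypi : ℕ → BB R lam lami deli q0 q1 A n
  | 0 => 1
  | 1 => YYi R lam lami deli q0 q1 A n
  | (k + 2) => XXi R lam lami deli q0 q1 A n (k + 1) * Ypi (k + 1) * XXi R lam lami deli q0 q1 A n (k + 1)

/-- The set of the images of the generators (and their inverses) of `BB_{m+1}` inside `BB_n`.
Its `Algebra.adjoin` is the image of the canonical algebra homomorphism `BB_{m+1} → BB_n`. -/
noncomputable def genSet (m : ℕ) : Set (BB R lam lami deli q0 q1 A n) :=
  {a | a = YY R lam lami deli q0 q1 A n ∨ a = YYi R lam lami deli q0 q1 A n ∨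
    ∃ i, 1 ≤ i ∧ i ≤ m ∧ (a = XX R lam lami deli q0 q1 A n i ∨ a = XXi R lam lami deli q0 q1 A n i)}

/-- The image of the canonical algebra homomorphism `BB_{m+1}(R) → BB_n(R)`, realized as the
subalgebra generated by the images of the generators `Y, Y⁻¹, X_1, …, X_m` (and inverses). -/
noncomputable def sub (m : ℕ) : Subalgebra R (BB R lam lami deli q0 q1 A n) :=
  Algebra.adjoin R (genSet R lam lami deli q0 q1 A n m)

/-- `X(i,j) = X_i X_{i+1} ⋯ X_j`. -/
noncomputable def Xprod (i j : ℕ) : BB R lam lami deli q0 q1 A n :=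
  ((List.range (j + 1 - i)).map (fun k => XX R lam lami deli q0 q1 A n (i + k))).prod

/-- `E(i,j) = e_i e_{i+2} ⋯ e_j`. -/
noncomputable def Eprod (i j : ℕ) : BB R lam lami deli q0 q1 A n :=
  ((List.range ((j - i) / 2 + 1)).map (fun k => ee R lam lami deli q0 q1 A n (i + 2 * k))).prod

/-- `H_1 = e_1`, `H_{m+1} = e_{m+1} X(m+2, 2m+1) X(m+1, 2m) H_m`. -/
noncomputable def H : ℕ → BB R lam lami deli q0 q1 A n
  | 0 => 1
  | 1 => ee R lam lami deli q0 q1 A n 1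
  | (k + 2) => ee R lam lami deli q0 q1 A n (k + 2) *
      Xprod R lam lami deli q0 q1 A n (k + 3) (2 * k + 3) *
      Xprod R lam lami deli q0 q1 A n (k + 2) (2 * k + 2) * H (k + 1)

end BMWB

namespace BMWB

/-- Elements of an algebra satisfying the relations of the type B BMW algebra on `N` strands. -/
structure Sys (R B : Type*) [CommRing R] [Ring B] [Algebra R B] (N : ℕ) where
  X : ℕ → B
  Xi : ℕ → B
  e : ℕ → B
  Y : B
  Yi : B
  lam : R
  lami : R
  del : R
  deli : R
  lam_mul : lam * lami = 1
  del_mul : del * deli = 1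
  X_mul_Xi : ∀ i, X i * Xi i = 1
  Xi_mul_X : ∀ i, Xi i * X i = 1
  Y_mul_Yi : Y * Yi = 1
  Yi_mul_Y : Yi * Y = 1
  Xi_eq : ∀ i, Xi i = X i - del • (1 : B) + del • e i
  X_comm : ∀ i j, 1 ≤ i → i + 1 < j → j < N → X i * X j = X j * X i
  braid : ∀ i, 1 ≤ i → i + 1 < N → X i * X (i + 1) * X i = X (i + 1) * X i * X (i + 1)
  X_e : ∀ i, 1 ≤ i → i < N → X i * e i = lam • e i
  e_X : ∀ i, 1 ≤ i → i < N → e i * X i = lam • e i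
  e_X_e : ∀ i, 1 ≤ i → i + 1 < N → e (i + 1) * X i * e (i + 1) = lami • e (i + 1)
  e_Xi_e : ∀ i, 1 ≤ i → i + 1 < N → e (i + 1) * Xi i * e (i + 1) = lam • e (i + 1)
  Y_X : ∀ i, 2 ≤ i → i < N → Y * X i = X i * Y
  YXYX : 1 < N → X 1 * Y * X 1 * Y = Y * X 1 * Y * X 1
  YXY_e : 1 < N → Y * X 1 * Y * e 1 = e 1
  Y_mem : ∃ a b : R, Y = a • (1 : B) + b • Yi
  Yi_mem : ∃ a b : R, Yi = a • (1 : B) + b • Y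
  e_Y_e : 1 < N → ∃ a : R, e 1 * Y * e 1 = a • e 1

theorem mul_inv_swap {B : Type*} [Ring B] {a x xi y yi : B} (hx : x * xi = 1) (hy : yi * y = 1)
    (h : a * x = y * a) : a * xi = yi * a := by
  calc a * xi = yi * (y * a) * xi := by rw [← mul_assoc yi, hy, one_mul]
    _ = yi * a := by rw [← h, mul_assoc, mul_assoc, hx, mul_one]

namespace Sys

variable {R B : Type*} [CommRing R] [Ring B] [Algebra R B] {N : ℕ} (d : Sys R B N)

theorem X_eq (i : ℕ) : d.X i = d.Xi i + d.del • (1 : B) - d.del • d.e i := by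
  rw [d.Xi_eq]; abel

theorem e_eq (i : ℕ) : d.e i = 1 - d.deli • (d.X i - d.Xi i) := by
  have h : d.deli * d.del = 1 := by rw [mul_comm, d.del_mul]
  rw [d.Xi_eq, smul_sub, smul_add, smul_sub, smul_smul, smul_smul, h, one_smul, one_smul]; abel

theorem X_mul_Xi_assoc (i : ℕ) (b : B) : d.X i * (d.Xi i * b) = b := by
  rw [← mul_assoc, d.X_mul_Xi, one_mul]

theorem Xi_mul_X_assoc (i : ℕ) (b : B) : d.Xi i * (d.X i * b) = b := by
  rw [← mul_assoc, d.Xi_mul_X, one_mul]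

theorem Xi_e {i : ℕ} (h1 : 1 ≤ i) (h2 : i < N) : d.Xi i * d.e i = d.lami • d.e i := by
  have : d.Xi i * (d.lami • (d.X i * d.e i)) = d.lami • d.e i := by
    rw [mul_smul_comm, Xi_mul_X_assoc]
  rwa [d.X_e i h1 h2, smul_smul, mul_comm, d.lam_mul, one_smul] at this

theorem e_Xi {i : ℕ} (h1 : 1 ≤ i) (h2 : i < N) : d.e i * d.Xi i = d.lami • d.e i := by
  have : d.lami • (d.e i * d.X i) * d.Xi i = d.lami • d.e i := by
    rw [smul_mul_assoc, mul_assoc, d.X_mul_Xi, mul_one]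
  rwa [d.e_X i h1 h2, smul_smul, mul_comm, d.lam_mul, one_smul] at this

theorem e_mul_e {i : ℕ} (h1 : 1 ≤ i) (h2 : i < N) :
    d.e i * d.e i = (1 - d.deli * (d.lam - d.lami)) • d.e i := by
  nth_rw 1 [d.e_eq i]
  rw [sub_mul, one_mul, smul_mul_assoc, sub_mul, d.X_e i h1 h2, d.Xi_e h1 h2]
  module

/-- Swapping past `X i` implies swapping past `e`. -/
theorem swap_e {a : B} {i j : ℕ} (h : a * d.X i = d.X j * a) : a * d.e i = d.e j * a := by
  have h' := mul_inv_swap (d.X_mul_Xi i) (d.Xi_mul_X j) h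
  rw [d.e_eq, d.e_eq, mul_sub, sub_mul, mul_smul_comm, smul_mul_assoc, mul_sub, sub_mul, h, h',
    mul_one, one_mul]

theorem swap_Xi {a : B} {i j : ℕ} (h : a * d.X i = d.X j * a) : a * d.Xi i = d.Xi j * a :=
  mul_inv_swap (d.X_mul_Xi i) (d.Xi_mul_X j) h

section Neighbours

variable {k : ℕ} (h1 : 1 ≤ k) (h2 : k + 1 < N)
include h1 h2

theorem XX_X : d.X k * d.X (k + 1) * d.X k = d.X (k + 1) * (d.X k * d.X (k + 1)) := by
  rw [d.braid k h1 h2, mul_assoc]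

theorem XX_X' : d.X (k + 1) * d.X k * d.X (k + 1) = d.X k * (d.X (k + 1) * d.X k) := by
  rw [← d.braid k h1 h2, mul_assoc]

theorem XX_e : d.X k * d.X (k + 1) * d.e k = d.e (k + 1) * (d.X k * d.X (k + 1)) :=
  d.swap_e (d.XX_X h1 h2)

theorem XX_e' : d.X (k + 1) * d.X k * d.e (k + 1) = d.e k * (d.X (k + 1) * d.X k) :=
  d.swap_e (d.XX_X' h1 h2)

/-- `e_{k+1} e_k = e_{k+1} X_k X_{k+1}`. -/
theorem ee_down_right : d.e (k + 1) * d.e k = d.e (k + 1) * d.X k * d.X (k + 1) := by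
  have h : d.e k = d.Xi (k + 1) * d.Xi k * (d.e (k + 1) * (d.X k * d.X (k + 1))) := by
    rw [← d.XX_e h1 h2]
    simp only [mul_assoc, d.Xi_mul_X_assoc]
  have h3 : d.e (k + 1) * d.Xi (k + 1) = d.lami • d.e (k + 1) := d.e_Xi (by omega) h2
  rw [h]
  calc _ = (d.e (k + 1) * d.Xi (k + 1)) * d.Xi k * d.e (k + 1) * (d.X k * d.X (k + 1)) := by
        simp only [mul_assoc]
    _ = _ := by
        rw [h3, smul_mul_assoc, smul_mul_assoc, d.e_Xi_e k h1 h2, smul_smul, mul_comm d.lami,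
          d.lam_mul, one_smul, mul_assoc]

/-- `e_{k+1} e_k = X_k X_{k+1} e_k`. -/
theorem ee_down_left : d.e (k + 1) * d.e k = d.X k * d.X (k + 1) * d.e k := by
  rw [d.ee_down_right h1 h2, d.XX_e h1 h2, mul_assoc]

theorem e_down_up : d.e (k + 1) * d.e k * d.e (k + 1) = d.e (k + 1) := by
  have h3 : d.e (k + 1) * d.e (k + 1) = (1 - d.deli * (d.lam - d.lami)) • d.e (k + 1) :=
    d.e_mul_e (by omega) h2
  rw [d.e_eq k]
  simp only [mul_sub, sub_mul, mul_smul_comm, smul_mul_assoc, mul_one, h3, d.e_X_e k h1 h2,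
    d.e_Xi_e k h1 h2]
  module

theorem e_up_down : d.e k * d.e (k + 1) * d.e k = d.e k := by
  have h : d.e k = d.Xi (k + 1) * d.Xi k * (d.e (k + 1) * (d.X k * d.X (k + 1))) := by
    rw [← d.XX_e h1 h2]
    simp only [mul_assoc, d.Xi_mul_X_assoc]
  have h3 : d.X k * d.X (k + 1) * d.e k = d.e (k + 1) * d.e k := by rw [d.ee_down_left h1 h2]
  calc d.e k * d.e (k + 1) * d.e k
      = d.Xi (k + 1) * d.Xi k * (d.e (k + 1) * (d.X k * d.X (k + 1))) * d.e (k + 1) * d.e k := by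
        rw [← h]
    _ = d.Xi (k + 1) * d.Xi k * (d.X k * d.X (k + 1) * d.e k) * d.e (k + 1) * d.e k := by
        rw [d.XX_e h1 h2]
    _ = d.Xi (k + 1) * d.Xi k * (d.e (k + 1) * d.e k * d.e (k + 1)) * d.e k := by
        rw [h3]; simp only [mul_assoc]
    _ = d.Xi (k + 1) * d.Xi k * (d.X k * d.X (k + 1) * d.e k) := by
        rw [d.e_down_up h1 h2, h3, mul_assoc]
    _ = d.e k := by simp only [mul_assoc, d.Xi_mul_X_assoc]

/-- `e_k e_{k+1} = e_k X_{k+1} X_k`. -/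
theorem ee_up_right : d.e k * d.e (k + 1) = d.e k * d.X (k + 1) * d.X k := by
  have h : d.e k * (d.X (k + 1) * d.X k) = d.X (k + 1) * d.X k * d.e (k + 1) :=
    (d.XX_e' h1 h2).symm
  have h3 : d.X k * d.e k = d.lam • d.e k := d.X_e k h1 (by omega)
  have h5 : d.X k * d.X (k + 1) * d.e k = d.e (k + 1) * d.e k := by rw [d.ee_down_left h1 h2]
  have h12 : d.e k * d.e (k + 1) * (d.X k * d.X (k + 1)) = d.e k := by
    rw [mul_assoc, ← d.XX_e h1 h2, h5, ← mul_assoc, d.e_up_down h1 h2]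
  have h13 : d.e k * d.e (k + 1) = d.e k * d.Xi (k + 1) * d.Xi k := by
    calc d.e k * d.e (k + 1)
      = d.e k * d.e (k + 1) * (d.X k * d.X (k + 1)) * d.Xi (k + 1) * d.Xi k := by
          simp only [mul_assoc, d.X_mul_Xi, mul_one]
      _ = _ := by rw [h12]
  have h14 : d.e k * d.Xi (k + 1) * d.e k = d.lam • d.e k := by
    calc d.e k * d.Xi (k + 1) * d.e k = d.e k * d.Xi (k + 1) * d.Xi k * (d.X k * d.e k) := by
          simp only [mul_assoc, d.Xi_mul_X_assoc]
      _ = d.lam • d.e k := by rw [← h13, h3, mul_smul_comm, d.e_up_down h1 h2]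
  calc d.e k * d.e (k + 1)
      = d.e k * (d.Xi k * d.Xi (k + 1)) * (d.X (k + 1) * d.X k * d.e (k + 1)) := by
        simp only [mul_assoc, d.Xi_mul_X_assoc]
    _ = (d.e k * d.Xi k) * d.Xi (k + 1) * d.e k * (d.X (k + 1) * d.X k) := by
        rw [← h]; simp only [mul_assoc]
    _ = d.e k * d.X (k + 1) * d.X k := by
        rw [d.e_Xi h1 (by omega), smul_mul_assoc, smul_mul_assoc, h14, smul_smul,
          mul_comm d.lami, d.lam_mul, one_smul, mul_assoc]

/-- `e_k e_{k+1} = X_{k+1} X_k e_{k+1}`. -/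
theorem ee_up_left : d.e k * d.e (k + 1) = d.X (k + 1) * d.X k * d.e (k + 1) := by
  rw [d.ee_up_right h1 h2, d.XX_e' h1 h2, mul_assoc]

end Neighbours

section Opposite

open MulOpposite

theorem W_comm (h : 1 < N) : d.Y * d.X 1 * d.Y * d.X 1 = d.X 1 * (d.Y * d.X 1 * d.Y) := by
  rw [← d.YXYX h]; simp only [mul_assoc]

theorem e_YXY (h : 1 < N) : d.e 1 * (d.Y * d.X 1 * d.Y) = d.e 1 := by
  rw [← d.swap_e (d.W_comm h), d.YXY_e h]

theorem e_Yi_Xi_Yi (h : 1 < N) : d.e 1 * (d.Yi * (d.Xi 1 * d.Yi)) = d.e 1 := by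
  conv_lhs => rw [← d.e_YXY h]
  calc _ = d.e 1 * d.Y * (d.X 1 * ((d.Y * d.Yi) * (d.Xi 1 * d.Yi))) := by simp only [mul_assoc]
    _ = d.e 1 := by
      rw [d.Y_mul_Yi, one_mul, d.X_mul_Xi_assoc, mul_assoc, d.Y_mul_Yi, mul_one]

theorem e_Yi_e (h : 1 < N) : ∃ a : R, d.e 1 * (d.Yi * d.e 1) = a • d.e 1 := by
  obtain ⟨a, b, hab⟩ := d.Yi_mem
  obtain ⟨c, hc⟩ := d.e_Y_e h
  refine ⟨a * (1 - d.deli * (d.lam - d.lami)) + b * c, ?_⟩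
  rw [hab, add_mul, smul_mul_assoc, smul_mul_assoc, one_mul, mul_add, mul_smul_comm,
    mul_smul_comm, d.e_mul_e le_rfl h, ← mul_assoc, hc]
  module

/-- The system obtained by reversing products and inverting generators. -/
def op : Sys R Bᵐᵒᵖ N where
  X i := MulOpposite.op (d.Xi i)
  Xi i := MulOpposite.op (d.X i)
  e i := MulOpposite.op (d.e i)
  Y := MulOpposite.op d.Yi
  Yi := MulOpposite.op d.Y
  lam := d.lami
  lami := d.lam
  del := -d.del
  deli := -d.deli
  lam_mul := by rw [mul_comm, d.lam_mul]
  del_mul := by rw [neg_mul_neg, d.del_mul]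
  X_mul_Xi i := by rw [← op_mul, d.X_mul_Xi, op_one]
  Xi_mul_X i := by rw [← op_mul, d.Xi_mul_X, op_one]
  Y_mul_Yi := by rw [← op_mul, d.Y_mul_Yi, op_one]
  Yi_mul_Y := by rw [← op_mul, d.Yi_mul_Y, op_one]
  Xi_eq i := by
    rw [d.X_eq, op_sub, op_add, op_smul, op_smul, op_one]; module
  X_comm i j h1 h2 h3 := by
    rw [← op_mul, ← op_mul]
    refine congrArg _ (d.swap_Xi (d.swap_Xi (d.X_comm i j h1 h2 h3)).symm)
  braid i h1 h2 := by
    simp only [← op_mul]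
    refine congrArg _ (left_inv_eq_right_inv (a := d.X i * d.X (i + 1) * d.X i) ?_ ?_)
    · simp only [mul_assoc, d.Xi_mul_X_assoc, d.Xi_mul_X]
    · rw [d.braid i h1 h2]
      simp only [mul_assoc, d.X_mul_Xi_assoc, d.X_mul_Xi]
  X_e i h1 h2 := by rw [← op_mul, d.e_Xi h1 h2, op_smul]
  e_X i h1 h2 := by rw [← op_mul, d.Xi_e h1 h2, op_smul]
  e_X_e i h1 h2 := by
    rw [← op_mul, ← op_mul, ← mul_assoc, d.e_Xi_e i h1 h2, op_smul]
  e_Xi_e i h1 h2 := by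
    rw [← op_mul, ← op_mul, ← mul_assoc, d.e_X_e i h1 h2, op_smul]
  Y_X i h1 h2 := by
    rw [← op_mul, ← op_mul]
    exact congrArg _ (mul_inv_swap d.Y_mul_Yi d.Yi_mul_Y (d.swap_Xi (d.Y_X i h1 h2)).symm)
  YXYX h := by
    simp only [← op_mul]
    refine congrArg _ (left_inv_eq_right_inv (a := d.X 1 * d.Y * d.X 1 * d.Y) ?_ ?_)
    · calc _ = d.Yi * (d.Xi 1 * (d.Yi * ((d.Xi 1 * d.X 1) * d.Y) * d.X 1) * d.Y) := by
            simp only [mul_assoc]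
        _ = _ := by simp only [d.Xi_mul_X, d.Yi_mul_Y, one_mul]
    · rw [d.YXYX h]
      calc _ = d.Y * (d.X 1 * (d.Y * ((d.X 1 * d.Xi 1) * d.Yi) * d.Xi 1) * d.Yi) := by
            simp only [mul_assoc]
        _ = _ := by simp only [d.X_mul_Xi, d.Y_mul_Yi, one_mul]
  YXY_e h := by
    simp only [← op_mul]
    rw [d.e_Yi_Xi_Yi h]
  Y_mem := by
    obtain ⟨a, b, h⟩ := d.Yi_mem
    exact ⟨a, b, by conv_lhs => rw [h, op_add, op_smul, op_smul, op_one]⟩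
  Yi_mem := by
    obtain ⟨a, b, h⟩ := d.Y_mem
    exact ⟨a, b, by conv_lhs => rw [h, op_add, op_smul, op_smul, op_one]⟩
  e_Y_e h := by
    obtain ⟨a, ha⟩ := d.e_Yi_e h
    exact ⟨a, by rw [← op_mul, ← op_mul, ha, op_smul]⟩

end Opposite

section Neighbours

variable {k : ℕ} (h1 : 1 ≤ k) (h2 : k + 1 < N)
include h1 h2

theorem ee_down_left' : d.e (k + 1) * d.e k = d.Xi k * d.Xi (k + 1) * d.e k := by
  have := congrArg MulOpposite.unop (d.op.ee_up_right h1 h2)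
  simpa [op, mul_assoc] using this

theorem ee_down_right' : d.e (k + 1) * d.e k = d.e (k + 1) * d.Xi k * d.Xi (k + 1) := by
  have := congrArg MulOpposite.unop (d.op.ee_up_left h1 h2)
  simpa [op, mul_assoc] using this

theorem ee_up_left' : d.e k * d.e (k + 1) = d.Xi (k + 1) * d.Xi k * d.e (k + 1) := by
  have := congrArg MulOpposite.unop (d.op.ee_down_right h1 h2)
  simpa [op, mul_assoc] using this

theorem ee_up_right' : d.e k * d.e (k + 1) = d.e k * d.Xi (k + 1) * d.Xi k := by
  have := congrArg MulOpposite.unop (d.op.ee_down_left h1 h2)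
  simpa [op, mul_assoc] using this

theorem Xi_succ_e : d.Xi (k + 1) * d.e k = d.X k * (d.e (k + 1) * d.e k) := by
  rw [d.ee_down_left' h1 h2, mul_assoc, d.X_mul_Xi_assoc]

theorem X_succ_e : d.X (k + 1) * d.e k = d.Xi k * (d.e (k + 1) * d.e k) := by
  rw [d.ee_down_left h1 h2, mul_assoc, d.Xi_mul_X_assoc]

theorem e_succ_Xi : d.e (k + 1) * d.Xi k = d.e (k + 1) * d.e k * d.X (k + 1) := by
  rw [d.ee_down_right' h1 h2, mul_assoc, d.Xi_mul_X, mul_one]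

theorem e_X_succ : d.e k * d.X (k + 1) = d.e k * d.e (k + 1) * d.Xi k := by
  rw [d.ee_up_right h1 h2, mul_assoc, d.X_mul_Xi, mul_one]

theorem e_Xi_succ : d.e k * d.Xi (k + 1) = d.e k * d.e (k + 1) * d.X k := by
  rw [d.ee_up_right' h1 h2, mul_assoc, d.Xi_mul_X, mul_one]

theorem Xi_e_succ : d.Xi k * d.e (k + 1) = d.X (k + 1) * (d.e k * d.e (k + 1)) := by
  rw [d.ee_up_left' h1 h2, mul_assoc, d.X_mul_Xi_assoc]

theorem e_Xi_succ_e : d.e k * d.Xi (k + 1) * d.e k = d.lam • d.e k := by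
  rw [d.e_Xi_succ h1 h2, mul_assoc, d.X_e k h1 (by omega), mul_smul_comm, d.e_up_down h1 h2]

end Neighbours

theorem X_sq {i : ℕ} (h1 : 1 ≤ i) (h2 : i < N) :
    d.X i * d.X i = 1 + d.del • d.X i - (d.del * d.lam) • d.e i := by
  nth_rw 1 [d.X_eq i]
  rw [sub_mul, add_mul, d.Xi_mul_X, smul_mul_assoc, smul_mul_assoc, one_mul, d.e_X i h1 h2,
    smul_smul]

theorem deli_mul : d.deli * d.del = 1 := by rw [mul_comm, d.del_mul]

theorem lami_mul : d.lami * d.lam = 1 := by rw [mul_comm, d.lam_mul]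

theorem e_eq_sq {i : ℕ} (h1 : 1 ≤ i) (h2 : i < N) :
    d.e i = (d.lami * d.deli) • (1 + d.del • d.X i - d.X i * d.X i) := by
  rw [d.X_sq h1 h2, sub_sub_cancel, smul_smul]
  rw [show d.lami * d.deli * (d.del * d.lam) = (d.deli * d.del) * (d.lami * d.lam) by ring,
    d.deli_mul, d.lami_mul, one_mul, one_smul]

/-- The elements `Y'_i = X_{i-1} ⋯ X_1 Y X_1 ⋯ X_{i-1}`. -/
def Yp : ℕ → B
  | 0 => 1
  | 1 => d.Y
  | (k + 2) => d.X (k + 1) * Yp (k + 1) * d.X (k + 1)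

/-- The inverses of the elements `Y'_i`. -/
def Ypi : ℕ → B
  | 0 => 1
  | 1 => d.Yi
  | (k + 2) => d.Xi (k + 1) * Ypi (k + 1) * d.Xi (k + 1)

theorem Yp_succ {k : ℕ} (h : 1 ≤ k) : d.Yp (k + 1) = d.X k * d.Yp k * d.X k := by
  obtain ⟨k, rfl⟩ := Nat.exists_eq_add_of_le' h; rfl

theorem Ypi_succ {k : ℕ} (h : 1 ≤ k) : d.Ypi (k + 1) = d.Xi k * d.Ypi k * d.Xi k := by
  obtain ⟨k, rfl⟩ := Nat.exists_eq_add_of_le' h; rfl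

theorem op_Yp : ∀ k, d.op.Yp k = MulOpposite.op (d.Ypi k)
  | 0 => rfl
  | 1 => rfl
  | (k + 2) => by
    rw [Yp, Ypi, op_Yp (k + 1)]
    simp [op, mul_assoc]

theorem op_Ypi : ∀ k, d.op.Ypi k = MulOpposite.op (d.Yp k)
  | 0 => rfl
  | 1 => rfl
  | (k + 2) => by
    rw [Yp, Ypi, op_Ypi (k + 1)]
    simp [op, mul_assoc]

theorem Yp_mul_Ypi : ∀ k, d.Yp k * d.Ypi k = 1
  | 0 => one_mul 1
  | 1 => d.Y_mul_Yi
  | (k + 2) => by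
    have : d.Yp (k + 2) * d.Ypi (k + 2) = d.X (k + 1) * (d.Yp (k + 1) * (d.X (k + 1) *
      (d.Xi (k + 1) * (d.Ypi (k + 1) * d.Xi (k + 1))))) := by
      simp only [Yp, Ypi, mul_assoc]
    rw [this, d.X_mul_Xi_assoc, ← mul_assoc (d.Yp (k + 1)), Yp_mul_Ypi (k + 1), one_mul,
      d.X_mul_Xi]

theorem Ypi_mul_Yp : ∀ k, d.Ypi k * d.Yp k = 1
  | 0 => one_mul 1
  | 1 => d.Yi_mul_Y
  | (k + 2) => by
    have : d.Ypi (k + 2) * d.Yp (k + 2) = d.Xi (k + 1) * (d.Ypi (k + 1) * (d.Xi (k + 1) *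
      (d.X (k + 1) * (d.Yp (k + 1) * d.X (k + 1))))) := by
      simp only [Yp, Ypi, mul_assoc]
    rw [this, d.Xi_mul_X_assoc, ← mul_assoc (d.Ypi (k + 1)), Ypi_mul_Yp (k + 1), one_mul,
      d.Xi_mul_X]

/-- The subalgebra generated by `Y, X_1, …, X_{k-1}` and their inverses. -/
def A (k : ℕ) : Subalgebra R B :=
  Algebra.adjoin R {b | (1 ≤ k ∧ (b = d.Y ∨ b = d.Yi)) ∨
    ∃ i, 1 ≤ i ∧ i < k ∧ (b = d.X i ∨ b = d.Xi i)}

theorem A_mono {j k : ℕ} (h : j ≤ k) : d.A j ≤ d.A k := by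
  apply Algebra.adjoin_mono
  rintro b (⟨h1, h2⟩ | ⟨i, h1, h2, h3⟩)
  · exact Or.inl ⟨h1.trans h, h2⟩
  · exact Or.inr ⟨i, h1, h2.trans_le h, h3⟩

theorem X_mem_A {i k : ℕ} (h1 : 1 ≤ i) (h2 : i < k) : d.X i ∈ d.A k :=
  Algebra.subset_adjoin (Or.inr ⟨i, h1, h2, Or.inl rfl⟩)

theorem Xi_mem_A {i k : ℕ} (h1 : 1 ≤ i) (h2 : i < k) : d.Xi i ∈ d.A k :=
  Algebra.subset_adjoin (Or.inr ⟨i, h1, h2, Or.inr rfl⟩)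

theorem e_mem_A {i k : ℕ} (h1 : 1 ≤ i) (h2 : i < k) : d.e i ∈ d.A k := by
  rw [d.e_eq]
  exact sub_mem (one_mem _) (Subalgebra.smul_mem _ (sub_mem (d.X_mem_A h1 h2) (d.Xi_mem_A h1 h2)) _)

theorem Yp_mem_A : ∀ {j k : ℕ}, j ≤ k → d.Yp j ∈ d.A k
  | 0, _, _ => one_mem _
  | 1, _, h => Algebra.subset_adjoin (Or.inl ⟨h, Or.inl rfl⟩)
  | (j + 2), k, h =>
    mul_mem (mul_mem (d.X_mem_A (by omega) (by omega)) (Yp_mem_A (by omega)))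
      (d.X_mem_A (by omega) (by omega))

theorem Ypi_mem_A : ∀ {j k : ℕ}, j ≤ k → d.Ypi j ∈ d.A k
  | 0, _, _ => one_mem _
  | 1, _, h => Algebra.subset_adjoin (Or.inl ⟨h, Or.inr rfl⟩)
  | (j + 2), k, h =>
    mul_mem (mul_mem (d.Xi_mem_A (by omega) (by omega)) (Ypi_mem_A (by omega)))
      (d.Xi_mem_A (by omega) (by omega))

theorem A_induction {k : ℕ} {z : B} (hX : ∀ i, 1 ≤ i → i < k → d.X i * z = z * d.X i)
    (hY : 1 ≤ k → d.Y * z = z * d.Y) {a : B} (ha : a ∈ d.A k) : a * z = z * a := by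
  have : d.A k ≤ Subalgebra.centralizer R {z} := by
    apply Algebra.adjoin_le
    rintro b (⟨h1, rfl | rfl⟩ | ⟨i, h1, h2, rfl | rfl⟩) <;>
      rw [SetLike.mem_coe, Subalgebra.mem_centralizer_iff] <;> rintro _ rfl
    · exact (hY h1).symm
    · exact mul_inv_swap d.Y_mul_Yi d.Yi_mul_Y (hY h1).symm
    · exact (hX i h1 h2).symm
    · exact d.swap_Xi (hX i h1 h2).symm
  exact ((Subalgebra.mem_centralizer_iff R).1 (this ha) z rfl).symm

theorem A_X {k i : ℕ} (h1 : k < i) (h2 : i < N) {a : B} (ha : a ∈ d.A k) :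
    a * d.X i = d.X i * a := by
  refine d.A_induction (fun j hj hj' => d.X_comm j i hj (by omega) h2) (fun h => ?_) ha
  exact d.Y_X i (by omega) h2

theorem A_Xi {k i : ℕ} (h1 : k < i) (h2 : i < N) {a : B} (ha : a ∈ d.A k) :
    a * d.Xi i = d.Xi i * a := d.swap_Xi (d.A_X h1 h2 ha)

theorem A_e {k i : ℕ} (h1 : k < i) (h2 : i < N) {a : B} (ha : a ∈ d.A k) :
    a * d.e i = d.e i * a := d.swap_e (d.A_X h1 h2 ha)

theorem Y_Yp : ∀ {j : ℕ}, 1 < j → j ≤ N → d.Y * d.Yp j = d.Yp j * d.Y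
  | 2, _, h2 => by
    show d.Y * (d.X 1 * d.Y * d.X 1) = d.X 1 * d.Y * d.X 1 * d.Y
    rw [d.YXYX (by omega)]; simp only [mul_assoc]
  | (j + 3), _, h2 => by
    have h := Y_Yp (j := j + 2) (by omega) (by omega)
    have h' := d.Y_X (j + 2) (by omega) (by omega)
    show d.Y * (d.X (j + 2) * d.Yp (j + 2) * d.X (j + 2)) =
      d.X (j + 2) * d.Yp (j + 2) * d.X (j + 2) * d.Y
    rw [mul_assoc _ _ d.Y, ← h', mul_assoc _ _ (d.Y * _), ← mul_assoc _ d.Y, ← h,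
      ← mul_assoc, ← mul_assoc, h']
    simp only [mul_assoc]

theorem X_Yp {i j : ℕ} (h1 : 1 ≤ i) (h2 : i + 1 < j) (h3 : j ≤ N) :
    d.X i * d.Yp j = d.Yp j * d.X i := by
  obtain ⟨l, rfl⟩ := Nat.exists_eq_add_of_le h2
  induction l with
  | zero =>
    have hc := d.A_X (k := i) (i := i + 1) (by omega) (by omega) (d.Yp_mem_A le_rfl)
    have hb := d.braid i h1 (by omega)
    rw [add_zero, d.Yp_succ (by omega), d.Yp_succ h1]
    calc _ = (d.X i * d.X (i + 1) * d.X i) * d.Yp i * d.X i * d.X (i + 1) := by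
          simp only [mul_assoc]
      _ = d.X (i + 1) * d.X i * (d.Yp i * d.X (i + 1)) * d.X i * d.X (i + 1) := by
          rw [hb, hc]; simp only [mul_assoc]
      _ = d.X (i + 1) * d.X i * d.Yp i * (d.X (i + 1) * d.X i * d.X (i + 1)) := by
          simp only [mul_assoc]
      _ = _ := by rw [← hb]; simp only [mul_assoc]
  | succ l ih =>
    have h := ih (by omega) (by omega)
    have hc := d.X_comm i (i + 1 + 1 + l) h1 (by omega) (by omega)
    rw [Nat.succ_eq_add_one] at h ⊢
    rw [← add_assoc, d.Yp_succ (by omega)]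
    rw [mul_assoc _ _ (d.X i), ← hc, mul_assoc _ _ (d.X i * _), ← mul_assoc _ (d.X i), ← h,
      ← mul_assoc, ← mul_assoc, hc]
    simp only [mul_assoc]

theorem A_Yp {k j : ℕ} (h1 : k < j) (h2 : j ≤ N) {a : B} (ha : a ∈ d.A k) :
    a * d.Yp j = d.Yp j * a :=
  d.A_induction (fun _ hi hi' => d.X_Yp hi (by omega) h2) (fun h => d.Y_Yp (by omega) h2) ha

theorem A_Ypi {k j : ℕ} (h1 : k < j) (h2 : j ≤ N) {a : B} (ha : a ∈ d.A k) :
    a * d.Ypi j = d.Ypi j * a :=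
  mul_inv_swap (d.Yp_mul_Ypi j) (d.Ypi_mul_Yp j) (d.A_Yp h1 h2 ha)

theorem Yp_X_Yp_X {k : ℕ} (h1 : 1 ≤ k) (h2 : k < N) :
    d.Yp k * d.X k * d.Yp k * d.X k = d.X k * (d.Yp k * d.X k * d.Yp k) := by
  have := d.A_Yp (k := k) (j := k + 1) (by omega) (by omega) (d.Yp_mem_A le_rfl)
  rw [d.Yp_succ h1] at this
  simpa only [mul_assoc] using this

theorem Yp_X_Yp_e {k : ℕ} (h1 : 1 ≤ k) (h2 : k < N) :
    d.Yp k * d.X k * d.Yp k * d.e k = d.e k := by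
  induction k, h1 using Nat.le_induction with
  | base => exact d.YXY_e h2
  | succ k h1 ih =>
    have hc := d.A_X (k := k) (i := k + 1) (by omega) (by omega) (d.Yp_mem_A le_rfl)
    have hb := d.braid k h1 (by omega)
    rw [d.Yp_succ h1]
    calc _ = d.X k * d.Yp k * (d.X k * d.X (k + 1) * d.X k) * d.Yp k * d.X k * d.e (k + 1) := by
          simp only [mul_assoc]
      _ = d.X k * (d.Yp k * d.X (k + 1)) * d.X k * (d.X (k + 1) * d.Yp k) * d.X k *
            d.e (k + 1) := by
          rw [hb]; simp only [mul_assoc]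
      _ = d.X k * d.X (k + 1) * (d.Yp k * d.X k * d.Yp k) *
            (d.X (k + 1) * d.X k * d.e (k + 1)) := by
          rw [← hc]; simp only [mul_assoc]; rw [← mul_assoc (d.X _) (d.Yp k) (d.X k * _), ← hc]
          simp only [mul_assoc]
      _ = d.X k * d.X (k + 1) * ((d.Yp k * d.X k * d.Yp k * d.e k) * d.e (k + 1)) := by
          rw [← d.ee_up_left h1 h2]; simp only [mul_assoc]
      _ = (d.X k * d.X (k + 1) * d.e k) * d.e (k + 1) := by
          rw [ih (by omega), mul_assoc _ (d.e k)]
      _ = d.e (k + 1) := by rw [← d.ee_down_left h1 h2, d.e_down_up h1 h2]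

theorem e_Yp_X_Yp {k : ℕ} (h1 : 1 ≤ k) (h2 : k < N) :
    d.e k * (d.Yp k * d.X k * d.Yp k) = d.e k := by
  rw [← d.swap_e (d.Yp_X_Yp_X h1 h2), d.Yp_X_Yp_e h1 h2]

theorem e_Yp_X {k : ℕ} (h1 : 1 ≤ k) (h2 : k < N) :
    d.e k * d.Yp k * d.X k = d.e k * d.Ypi k := by
  conv_rhs => rw [← d.e_Yp_X_Yp h1 h2]
  simp only [mul_assoc, d.Yp_mul_Ypi, mul_one]

theorem e_Ypi_Xi {k : ℕ} (h1 : 1 ≤ k) (h2 : k < N) :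
    d.e k * d.Ypi k * d.Xi k = d.e k * d.Yp k := by
  rw [← d.e_Yp_X h1 h2, mul_assoc, d.X_mul_Xi, mul_one]

theorem Xi_Ypi_e {k : ℕ} (h1 : 1 ≤ k) (h2 : k < N) :
    d.Xi k * d.Ypi k * d.e k = d.Yp k * d.e k := by
  conv_lhs => rw [← d.Yp_X_Yp_e h1 h2]
  calc _ = d.Xi k * ((d.Ypi k * d.Yp k) * (d.X k * (d.Yp k * d.e k))) := by simp only [mul_assoc]
    _ = _ := by rw [d.Ypi_mul_Yp, one_mul, d.Xi_mul_X_assoc]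

theorem e_Yp {k : ℕ} (h1 : 1 ≤ k) (h2 : k < N) :
    d.e k * d.Yp k = d.lam • (d.e k * d.Ypi (k + 1)) := by
  rw [d.Ypi_succ h1, ← mul_assoc, ← mul_assoc, d.e_Xi h1 h2, smul_mul_assoc, smul_mul_assoc,
    smul_smul, d.lam_mul, one_smul, d.e_Ypi_Xi h1 h2]

theorem ee_Yp {k : ℕ} (h1 : 1 ≤ k) (h2 : k + 1 < N) :
    d.e k * d.e (k + 1) * d.Yp k = d.Yp (k + 2) * (d.e k * d.e (k + 1)) := by
  have hc := d.A_e (k := k) (i := k + 1) (by omega) h2 (d.Yp_mem_A le_rfl)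
  rw [d.Yp_succ (by omega), d.Yp_succ h1]
  calc _ = d.X (k + 1) * d.X k * (d.e (k + 1) * d.Yp k) := by
        rw [d.ee_up_left h1 h2]; simp only [mul_assoc]
    _ = d.X (k + 1) * d.X k * d.Yp k * (d.e (k + 1) * d.e k * d.e (k + 1)) := by
        rw [← hc, d.e_down_up h1 h2]; simp only [mul_assoc]
    _ = _ := by rw [d.ee_down_left h1 h2]; simp only [mul_assoc]

theorem ee_Ypi {k : ℕ} (h1 : 1 ≤ k) (h2 : k + 1 < N) :
    d.e k * d.e (k + 1) * d.Ypi k = d.Ypi (k + 2) * (d.e k * d.e (k + 1)) :=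
  mul_inv_swap (d.Yp_mul_Ypi _) (d.Ypi_mul_Yp _) (d.ee_Yp h1 h2)

theorem e_Yp_Xi_e {k : ℕ} (h1 : 1 ≤ k) (h2 : k + 1 < N) :
    d.e k * d.Yp k * d.Xi (k + 1) * d.e k = d.e k * d.Ypi (k + 2) := by
  have hc := d.A_e (k := k) (i := k + 1) (by omega) h2 (d.Ypi_mem_A le_rfl)
  have hc' := d.A_Ypi (k := k + 1) (j := k + 2) (by omega) (by omega)
    (d.e_mem_A h1 (by omega))
  calc _ = (d.e k * d.Yp k * d.X k) * d.e (k + 1) * d.e k := by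
        rw [mul_assoc _ (d.Xi _), d.Xi_succ_e h1 h2]; simp only [mul_assoc]
    _ = d.e k * (d.Ypi k * d.e (k + 1)) * d.e k := by
        rw [d.e_Yp_X h1 (by omega), mul_assoc (d.e k)]
    _ = d.e k * d.e (k + 1) * d.Ypi k * d.e k := by rw [hc, ← mul_assoc (d.e k)]
    _ = d.Ypi (k + 2) * (d.e k * d.e (k + 1) * d.e k) := by
        rw [d.ee_Ypi h1 h2, mul_assoc]
    _ = _ := by rw [d.e_up_down h1 h2, hc']

theorem e_Ypi_e {k : ℕ} (h1 : 1 ≤ k) (h2 : k < N) :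
    ∃ a ∈ d.A (k - 1), d.e k * d.Ypi k * d.e k = a * d.e k := by
  induction k, h1 using Nat.le_induction with
  | base =>
    obtain ⟨a, ha⟩ := d.e_Yi_e h2
    refine ⟨a • 1, Subalgebra.smul_mem _ (one_mem _) _, ?_⟩
    rw [smul_mul_assoc, one_mul, ← ha, mul_assoc]; rfl
  | succ k h1 ih =>
    obtain ⟨a, ha, hae⟩ := ih (by omega)
    have hca := d.A_e (k := k - 1) (i := k + 1) (by omega) h2 ha
    have hcy := d.A_e (k := k) (i := k + 1) (by omega) h2 (d.Yp_mem_A le_rfl)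
    have hcyi := d.A_e (k := k) (i := k + 1) (by omega) h2 (d.Ypi_mem_A le_rfl)
    have hcX := d.A_X (k := k) (i := k + 1) (by omega) h2 (d.Ypi_mem_A le_rfl)
    refine ⟨a + d.del • d.Yp k - (d.del * d.lam) • d.Ypi k, ?_, ?_⟩
    · exact sub_mem (add_mem (d.A_mono (by omega) ha)
        (Subalgebra.smul_mem _ (d.Yp_mem_A le_rfl) _))
        (Subalgebra.smul_mem _ (d.Ypi_mem_A le_rfl) _)
    have t1 : d.e (k + 1) * (d.e k * (d.Ypi k * (d.e k * d.e (k + 1)))) = a * d.e (k + 1) := by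
      calc _ = d.e (k + 1) * (d.e k * d.Ypi k * d.e k) * d.e (k + 1) := by simp only [mul_assoc]
        _ = a * (d.e (k + 1) * d.e k * d.e (k + 1)) := by
          rw [hae, ← mul_assoc, ← hca]; simp only [mul_assoc]
        _ = _ := by rw [d.e_down_up h1 h2]
    have t2 : d.e (k + 1) * (d.e k * (d.Ypi k * (d.X (k + 1) * (d.e k * d.e (k + 1))))) =
        d.Yp k * d.e (k + 1) := by
      calc _ = d.e (k + 1) * (d.e k * d.Ypi k * d.Xi k) *
              (d.e (k + 1) * d.e k * d.e (k + 1)) := by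
            rw [← mul_assoc (d.X _), d.X_succ_e h1 h2]; simp only [mul_assoc]
        _ = d.e (k + 1) * d.e k * (d.Yp k * d.e (k + 1)) := by
          rw [d.e_Ypi_Xi h1 (by omega), d.e_down_up h1 h2]; simp only [mul_assoc]
        _ = (d.e (k + 1) * d.e k * d.e (k + 1)) * d.Yp k := by
          rw [hcy]; simp only [mul_assoc]
        _ = _ := by rw [d.e_down_up h1 h2, hcy]
    have t3 : d.e (k + 1) * (d.e k * (d.Ypi k * (d.e (k + 1) * (d.e k * d.e (k + 1))))) =
        d.Ypi k * d.e (k + 1) := by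
      calc _ = d.e (k + 1) * d.e k * d.Ypi k * (d.e (k + 1) * d.e k * d.e (k + 1)) := by
            simp only [mul_assoc]
        _ = d.e (k + 1) * d.e k * (d.Ypi k * d.e (k + 1)) := by
          rw [d.e_down_up h1 h2]; simp only [mul_assoc]
        _ = (d.e (k + 1) * d.e k * d.e (k + 1)) * d.Ypi k := by
          rw [hcyi]; simp only [mul_assoc]
        _ = _ := by rw [d.e_down_up h1 h2, hcyi]
    calc d.e (k + 1) * d.Ypi (k + 1) * d.e (k + 1)
        = (d.e (k + 1) * d.Xi k) * d.Ypi k * (d.Xi k * d.e (k + 1)) := by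
          rw [d.Ypi_succ h1]; simp only [mul_assoc]
      _ = d.e (k + 1) * d.e k * (d.X (k + 1) * d.Ypi k) * d.X (k + 1) * d.e k * d.e (k + 1) := by
          rw [d.e_succ_Xi h1 h2, d.Xi_e_succ h1 h2]; simp only [mul_assoc]
      _ = d.e (k + 1) * d.e k * d.Ypi k * (d.X (k + 1) * d.X (k + 1)) * d.e k * d.e (k + 1) := by
          rw [← hcX]; simp only [mul_assoc]
      _ = _ := by
          rw [d.X_sq (by omega) h2]
          simp only [mul_add, mul_sub, add_mul, sub_mul, mul_smul_comm, smul_mul_assoc, mul_one,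
            mul_assoc, t1, t2, t3]

section Submodules

open Submodule

theorem mul_span_mul_le {P Q W : Submodule R B} {x : B}
    (h : ∀ a ∈ P, ∀ b ∈ Q, a * x * b ∈ W) : P * span R {x} * Q ≤ W := by
  rw [mul_le]
  intro y hy b hb
  obtain ⟨a, ha, rfl⟩ := mem_mul_span_singleton.1 hy
  exact h a ha b hb

theorem mul_span_mul_mem {P Q : Submodule R B} {a b : B} (ha : a ∈ P) (x : B) (hb : b ∈ Q) :
    a * x * b ∈ P * span R {x} * Q :=
  mul_mem_mul (mul_mem_mul ha (mem_span_singleton_self x)) hb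

/-- The linear map `b ↦ x * (b * z)`. -/
def lr (R : Type*) {B : Type*} [CommRing R] [Ring B] [Algebra R B] (x z : B) : B →ₗ[R] B :=
  LinearMap.mulLeft R x ∘ₗ LinearMap.mulRight R z

theorem mem_comap_lr {W : Submodule R B} {x z b : B} : b ∈ W.comap (lr R x z) ↔ x * (b * z) ∈ W :=
  Iff.rfl

/-- The submodule underlying `d.A k`. -/
abbrev M (k : ℕ) : Submodule R B := Subalgebra.toSubmodule (d.A k)

/-- Right coset representatives. -/
def C : ℕ → Submodule R B
  | 0 => ⊥
  | (k + 1) => 1 ⊔ span R {d.Ypi (k + 1)} ⊔ span R {d.Xi k} * C k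

/-- Left coset representatives. -/
def D : ℕ → Submodule R B
  | 0 => ⊥
  | (k + 1) => 1 ⊔ span R {d.Yp (k + 1)} ⊔ D k * span R {d.X k}

theorem one_mem_C (k : ℕ) : (1 : B) ∈ d.C (k + 1) :=
  le_sup_left (a := (1 ⊔ span R {d.Ypi (k + 1)} : Submodule R B))
    (le_sup_left (a := (1 : Submodule R B)) (one_le.1 le_rfl))

theorem Ypi_mem_C (k : ℕ) : d.Ypi (k + 1) ∈ d.C (k + 1) :=
  le_sup_left (a := (1 ⊔ span R {d.Ypi (k + 1)} : Submodule R B))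
    (le_sup_right (a := (1 : Submodule R B)) (mem_span_singleton_self _))

theorem Xi_mul_mem_C {k : ℕ} {c : B} (hc : c ∈ d.C k) : d.Xi k * c ∈ d.C (k + 1) :=
  le_sup_right (a := (1 ⊔ span R {d.Ypi (k + 1)} : Submodule R B))
    (mul_mem_mul (mem_span_singleton_self _) hc)

theorem one_mem_D (k : ℕ) : (1 : B) ∈ d.D (k + 1) :=
  le_sup_left (a := (1 ⊔ span R {d.Yp (k + 1)} : Submodule R B))
    (le_sup_left (a := (1 : Submodule R B)) (one_le.1 le_rfl))

theorem Yp_mem_D (k : ℕ) : d.Yp (k + 1) ∈ d.D (k + 1) :=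
  le_sup_left (a := (1 ⊔ span R {d.Yp (k + 1)} : Submodule R B))
    (le_sup_right (a := (1 : Submodule R B)) (mem_span_singleton_self _))

theorem mul_X_mem_D {k : ℕ} {c : B} (hc : c ∈ d.D k) : c * d.X k ∈ d.D (k + 1) :=
  le_sup_right (a := (1 ⊔ span R {d.Yp (k + 1)} : Submodule R B))
    (mul_mem_mul hc (mem_span_singleton_self _))

theorem C_succ_le {k : ℕ} {W : Submodule R B} (h1 : 1 ∈ W) (h2 : d.Ypi (k + 1) ∈ W)
    (h3 : ∀ c ∈ d.C k, d.Xi k * c ∈ W) : d.C (k + 1) ≤ W := by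
  refine sup_le (sup_le (one_le.2 h1) ((span_singleton_le_iff_mem _ _).2 h2)) ?_
  rw [mul_le]
  intro y hy c hc
  obtain ⟨r, rfl⟩ := mem_span_singleton.1 hy
  rw [smul_mul_assoc]
  exact W.smul_mem _ (h3 c hc)

theorem D_succ_le {k : ℕ} {W : Submodule R B} (h1 : 1 ∈ W) (h2 : d.Yp (k + 1) ∈ W)
    (h3 : ∀ c ∈ d.D k, c * d.X k ∈ W) : d.D (k + 1) ≤ W := by
  refine sup_le (sup_le (one_le.2 h1) ((span_singleton_le_iff_mem _ _).2 h2)) ?_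
  rw [mul_le]
  intro c hc y hy
  obtain ⟨r, rfl⟩ := mem_span_singleton.1 hy
  rw [mul_smul_comm]
  exact W.smul_mem _ (h3 c hc)

theorem C_le_M : ∀ k, d.C k ≤ d.M k
  | 0 => bot_le
  | 1 => d.C_succ_le (one_mem (d.A _)) (d.Ypi_mem_A le_rfl) (fun c hc => by
      rw [(mem_bot R).1 hc, mul_zero]; exact zero_mem (d.A _))
  | (k + 2) => d.C_succ_le (one_mem (d.A _)) (d.Ypi_mem_A le_rfl) (fun c hc =>
      mul_mem (S := Subalgebra R B) (s := d.A _) (d.Xi_mem_A (by omega) (by omega)) (d.A_mono (by omega) (C_le_M (k + 1) hc)))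

theorem D_le_M : ∀ k, d.D k ≤ d.M k
  | 0 => bot_le
  | 1 => d.D_succ_le (one_mem (d.A _)) (d.Yp_mem_A le_rfl) (fun c hc => by
      rw [(mem_bot R).1 hc, zero_mul]; exact zero_mem (d.A _))
  | (k + 2) => d.D_succ_le (one_mem (d.A _)) (d.Yp_mem_A le_rfl) (fun c hc =>
      mul_mem (S := Subalgebra R B) (s := d.A _) (d.A_mono (by omega) (D_le_M (k + 1) hc)) (d.X_mem_A (by omega) (by omega)))

/-- The right-hand side of the right coset decomposition. -/
def T (n : ℕ) : Submodule R B := d.M n * d.C (n + 1) ⊔ d.D n * span R {d.e n} * d.M n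

/-- The right-hand side of the left coset decomposition. -/
def T' (n : ℕ) : Submodule R B := d.D (n + 1) * d.M n ⊔ d.M n * span R {d.e n} * d.C n

theorem mul_mem_T {n : ℕ} {a c : B} (ha : a ∈ d.A n) (hc : c ∈ d.C (n + 1)) : a * c ∈ d.T n :=
  le_sup_left (a := d.M n * d.C (n + 1)) (mul_mem_mul (M := d.M n) ha hc)

theorem mul_e_mul_mem_T {n : ℕ} {a c : B} (hc : c ∈ d.D n) (ha : a ∈ d.A n) :
    c * d.e n * a ∈ d.T n :=
  le_sup_right (a := d.M n * d.C (n + 1)) (mul_span_mul_mem (Q := d.M n) hc _ ha)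

theorem T_le {n : ℕ} {W : Submodule R B} (h1 : ∀ a ∈ d.A n, ∀ c ∈ d.C (n + 1), a * c ∈ W)
    (h2 : ∀ c ∈ d.D n, ∀ a ∈ d.A n, c * d.e n * a ∈ W) : d.T n ≤ W :=
  sup_le (mul_le.2 h1) (mul_span_mul_le h2)

theorem T'_le {n : ℕ} {W : Submodule R B} (h1 : ∀ c ∈ d.D (n + 1), ∀ a ∈ d.A n, c * a ∈ W)
    (h2 : ∀ a ∈ d.A n, ∀ c ∈ d.C n, a * d.e n * c ∈ W) : d.T' n ≤ W :=
  sup_le (mul_le.2 h1) (mul_span_mul_le h2)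

theorem op_A (k : ℕ) : d.op.A k = (d.A k).op := by
  rw [A, A, Subalgebra.op_adjoin]
  congr 1
  ext b
  simp only [op, Set.mem_ofPred_eq, Set.mem_preimage, ← MulOpposite.unop_inj,
    MulOpposite.unop_op, or_comm]

theorem op_M (k : ℕ) :
    d.op.M k = (d.M k).map (↑(MulOpposite.opLinearEquiv R : B ≃ₗ[R] Bᵐᵒᵖ) : B →ₗ[R] Bᵐᵒᵖ) := by
  rw [M, op_A]
  ext b
  constructor
  · intro h
    exact ⟨b.unop, h, rfl⟩
  · rintro ⟨a, ha, rfl⟩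
    exact ha

theorem map_op_span_singleton (x : B) : (span R {x}).map
    (↑(MulOpposite.opLinearEquiv R : B ≃ₗ[R] Bᵐᵒᵖ) : B →ₗ[R] Bᵐᵒᵖ) =
      span R {MulOpposite.op x} := by
  rw [map_span, Set.image_singleton]; rfl

theorem op_C : ∀ k, d.op.C k =
    (d.D k).map (↑(MulOpposite.opLinearEquiv R : B ≃ₗ[R] Bᵐᵒᵖ) : B →ₗ[R] Bᵐᵒᵖ)
  | 0 => by rw [C, D, Submodule.map_bot]
  | (k + 1) => by
    rw [C, D, Submodule.map_sup, Submodule.map_sup, map_op_mul, map_op_one,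
      map_op_span_singleton, map_op_span_singleton, op_C k, op_Ypi]
    rfl

theorem op_D : ∀ k, d.op.D k =
    (d.C k).map (↑(MulOpposite.opLinearEquiv R : B ≃ₗ[R] Bᵐᵒᵖ) : B →ₗ[R] Bᵐᵒᵖ)
  | 0 => by rw [C, D, Submodule.map_bot]
  | (k + 1) => by
    rw [C, D, Submodule.map_sup, Submodule.map_sup, map_op_mul, map_op_one,
      map_op_span_singleton, map_op_span_singleton, op_D k, op_Yp]
    rfl

theorem op_T (n : ℕ) : d.op.T n =
    (d.T' n).map (↑(MulOpposite.opLinearEquiv R : B ≃ₗ[R] Bᵐᵒᵖ) : B →ₗ[R] Bᵐᵒᵖ) := by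
  rw [T, T', Submodule.map_sup, map_op_mul, map_op_mul, map_op_mul, op_C, op_D, op_M,
    map_op_span_singleton, ← mul_assoc]
  rfl

/-- A decomposition for `d.op` gives the mirror decomposition for `d`. -/
theorem le_T'_of_op {n : ℕ} (h : d.op.M (n + 1) ≤ d.op.T n) : d.M (n + 1) ≤ d.T' n := by
  rw [op_M, op_T] at h
  exact (Submodule.map_le_map_iff_of_injective
    (MulOpposite.opLinearEquiv R : B ≃ₗ[R] Bᵐᵒᵖ).injective _ _).1 h

theorem M_le_of_mul_mem {k : ℕ} {W : Submodule R B} (h1 : 1 ∈ W)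
    (hY : 1 ≤ k → ∀ t ∈ W, t * d.Y ∈ W) (hYi : 1 ≤ k → ∀ t ∈ W, t * d.Yi ∈ W)
    (hX : ∀ i, 1 ≤ i → i < k → ∀ t ∈ W, t * d.X i ∈ W)
    (hXi : ∀ i, 1 ≤ i → i < k → ∀ t ∈ W, t * d.Xi i ∈ W) : d.M k ≤ W := by
  have key : ∀ b ∈ d.A k, ∀ t ∈ W, t * b ∈ W := by
    intro b hb
    induction hb using Algebra.adjoin_induction with
    | mem x hx =>
      rcases hx with ⟨h, rfl | rfl⟩ | ⟨i, h, h', rfl | rfl⟩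
      exacts [hY h, hYi h, hX i h h', hXi i h h']
    | algebraMap r =>
      intro t ht
      rw [← Algebra.commutes, ← Algebra.smul_def]
      exact W.smul_mem r ht
    | add x y _ _ hx hy => intro t ht; rw [mul_add]; exact add_mem (hx t ht) (hy t ht)
    | mul x y _ _ hx hy => intro t ht; rw [← mul_assoc]; exact hy _ (hx t ht)
  intro b hb
  simpa using key b hb 1 h1

theorem M_one_le : d.M 1 ≤ d.T 0 := by
  suffices h : d.M 1 ≤ 1 ⊔ span R {d.Yi} by
    refine h.trans (sup_le (one_le.2 ?_) ((span_singleton_le_iff_mem _ _).2 ?_))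
    · simpa using d.mul_mem_T (one_mem _) (d.one_mem_C 0)
    · simpa [Ypi] using d.mul_mem_T (one_mem _) (d.Ypi_mem_C 0)
  have h1 : (1 : B) ∈ (1 ⊔ span R {d.Yi} : Submodule R B) :=
    le_sup_left (a := (1 : Submodule R B)) (one_le.1 le_rfl)
  have hYi : d.Yi ∈ (1 ⊔ span R {d.Yi} : Submodule R B) :=
    le_sup_right (a := (1 : Submodule R B)) (mem_span_singleton_self _)
  have hW : ∀ (W : Submodule R B), 1 ∈ W → d.Yi ∈ W → (1 ⊔ span R {d.Yi} : Submodule R B) ≤ W :=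
    fun W h1 h2 => sup_le (one_le.2 h1) ((span_singleton_le_iff_mem _ _).2 h2)
  obtain ⟨a, b, hab⟩ := d.Y_mem
  obtain ⟨a', b', hab'⟩ := d.Yi_mem
  refine d.M_le_of_mul_mem h1 (fun _ => ?_) (fun _ => ?_) (by omega) (by omega)
  · refine hW (comap (LinearMap.mulRight R d.Y) (1 ⊔ span R {d.Yi})) ?_ ?_ <;>
      rw [mem_comap, LinearMap.mulRight_apply]
    · rw [one_mul, hab]
      exact add_mem (smul_mem _ _ h1) (smul_mem _ _ hYi)
    · rwa [d.Yi_mul_Y]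
  · refine hW (comap (LinearMap.mulRight R d.Yi) (1 ⊔ span R {d.Yi})) ?_ ?_ <;>
      rw [mem_comap, LinearMap.mulRight_apply]
    · rwa [one_mul]
    · have : d.Yi * d.Yi = a' • d.Yi + b' • 1 := by
        conv_lhs => rw [hab']
        rw [add_mul, smul_mul_assoc, smul_mul_assoc, one_mul, ← hab', d.Y_mul_Yi]
      rw [this]
      exact add_mem (smul_mem _ _ hYi) (smul_mem _ _ h1)

end Submodules

section Step

open Submodule

/-- A coarse decomposition of `d.M (m + 1)` as a bimodule over `d.A m`. -/
theorem M_succ_le_of_mem {m : ℕ} (hS : d.M (m + 1) ≤ d.T m) {W : Submodule R B}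
    (h1 : ∀ a ∈ d.A m, a ∈ W) (h2 : ∀ a ∈ d.A m, a * d.Ypi (m + 1) ∈ W)
    (h3 : 1 ≤ m → ∀ a ∈ d.A m, ∀ c ∈ d.A m, a * d.Xi m * c ∈ W)
    (h4 : 1 ≤ m → ∀ a ∈ d.A m, ∀ c ∈ d.A m, a * d.e m * c ∈ W) : d.M (m + 1) ≤ W := by
  refine hS.trans (d.T_le (fun a ha c hc => ?_) (fun c hc a ha => ?_))
  · refine d.C_succ_le (W := W.comap (LinearMap.mulLeft R a)) ?_ ?_ ?_ hc
    · simpa using h1 a ha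
    · simpa using h2 a ha
    · intro c hc
      rcases Nat.eq_zero_or_pos m with rfl | hm
      · rw [(mem_bot R).1 hc, mul_zero]; exact zero_mem _
      · rw [mem_comap, LinearMap.mulLeft_apply, ← mul_assoc]
        exact h3 hm a ha c (d.C_le_M m hc)
  · rcases Nat.eq_zero_or_pos m with rfl | hm
    · rw [(mem_bot R).1 hc, zero_mul, zero_mul]; exact zero_mem _
    · exact h4 hm c (d.D_le_M m hc) a ha

/-- The right-hand side of the right coset decomposition, with `D` replaced by `M`. -/
def T₀ (n : ℕ) : Submodule R B := d.M n * d.C (n + 1) ⊔ d.M n * span R {d.e n} * d.M n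

theorem mul_mem_T₀ {n : ℕ} {a c : B} (ha : a ∈ d.A n) (hc : c ∈ d.C (n + 1)) : a * c ∈ d.T₀ n :=
  le_sup_left (a := d.M n * d.C (n + 1)) (mul_mem_mul (M := d.M n) ha hc)

theorem mul_e_mul_mem_T₀ {n : ℕ} {a c : B} (hc : c ∈ d.A n) (ha : a ∈ d.A n) :
    c * d.e n * a ∈ d.T₀ n :=
  le_sup_right (a := d.M n * d.C (n + 1)) (mul_span_mul_mem (P := d.M n) (Q := d.M n) hc _ ha)

theorem mem_T₀ {n : ℕ} {a : B} (ha : a ∈ d.A n) : a ∈ d.T₀ n := by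
  simpa using d.mul_mem_T₀ ha (d.one_mem_C n)

theorem T₀_le {n : ℕ} {W : Submodule R B} (h1 : ∀ a ∈ d.A n, ∀ c ∈ d.C (n + 1), a * c ∈ W)
    (h2 : ∀ c ∈ d.A n, ∀ a ∈ d.A n, c * d.e n * a ∈ W) : d.T₀ n ≤ W :=
  sup_le (mul_le.2 h1) (mul_span_mul_le h2)

theorem A_mul_T₀ {n : ℕ} {a t : B} (ha : a ∈ d.A n) (ht : t ∈ d.T₀ n) : a * t ∈ d.T₀ n := by
  refine d.T₀_le (W := (d.T₀ n).comap (LinearMap.mulLeft R a)) (fun b hb c hc => ?_)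
    (fun c hc b hb => ?_) ht <;> rw [mem_comap, LinearMap.mulLeft_apply]
  · rw [← mul_assoc]; exact d.mul_mem_T₀ (mul_mem ha hb) hc
  · rw [← mul_assoc, ← mul_assoc]; exact d.mul_e_mul_mem_T₀ (mul_mem ha hc) hb

section

variable {m : ℕ} (hN : m + 1 < N) (hS : d.M (m + 1) ≤ d.T m)
include hN hS

theorem mul_Xi_mul_mem_T₀ {a b : B} (ha : a ∈ d.A (m + 1)) (hb : b ∈ d.A (m + 1)) :
    a * d.Xi (m + 1) * b ∈ d.T₀ (m + 1) := by
  refine d.T_le (W := (d.T₀ (m + 1)).comap (LinearMap.mulLeft R (a * d.Xi (m + 1))))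
    (fun x hx c hc => ?_) (fun y hy x hx => ?_) (hS hb) <;>
      rw [mem_comap, LinearMap.mulLeft_apply]
  · have hxX := d.A_Xi (i := m + 1) (by omega) hN hx
    rw [show a * d.Xi (m + 1) * (x * c) = (a * x) * (d.Xi (m + 1) * c) by
      rw [mul_assoc, ← mul_assoc (d.Xi _), ← hxX]; simp only [mul_assoc]]
    exact d.mul_mem_T₀ (mul_mem ha (d.A_mono (by omega) hx)) (d.Xi_mul_mem_C hc)
  · rcases Nat.eq_zero_or_pos m with rfl | hm
    · rw [(mem_bot R).1 hy, zero_mul, zero_mul, mul_zero]; exact zero_mem _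
    · have hy' := d.D_le_M m hy
      have hyX := d.A_Xi (i := m + 1) (by omega) hN hy'
      rw [show a * d.Xi (m + 1) * (y * d.e m * x) = (a * y * d.X m) * d.e (m + 1) * (d.e m * x) by
        calc _ = a * (d.Xi (m + 1) * y) * d.e m * x := by simp only [mul_assoc]
          _ = a * y * (d.Xi (m + 1) * d.e m) * x := by rw [← hyX]; simp only [mul_assoc]
          _ = _ := by rw [d.Xi_succ_e hm hN]; simp only [mul_assoc]]
      exact d.mul_e_mul_mem_T₀ (mul_mem (mul_mem ha (d.A_mono (by omega) hy'))
        (d.X_mem_A hm (by omega))) (mul_mem (d.e_mem_A hm (by omega)) (d.A_mono (by omega) hx))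

theorem T₀_mul_A {t b : B} (ht : t ∈ d.T₀ (m + 1)) (hb : b ∈ d.A (m + 1)) :
    t * b ∈ d.T₀ (m + 1) := by
  refine d.T₀_le (W := (d.T₀ (m + 1)).comap (LinearMap.mulRight R b)) (fun a ha c hc => ?_)
    (fun c hc x hx => ?_) ht <;> rw [mem_comap, LinearMap.mulRight_apply]
  · rw [mul_assoc, ← mem_comap_lr (R := R)]
    refine d.C_succ_le ?_ ?_ (fun c hc => ?_) hc <;> rw [mem_comap_lr]
    · rw [one_mul]; exact d.mem_T₀ (mul_mem ha hb)
    · rw [← d.A_Ypi (by omega) (by omega) hb, ← mul_assoc]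
      exact d.mul_mem_T₀ (mul_mem ha hb) (d.Ypi_mem_C _)
    · rw [mul_assoc, ← mul_assoc]
      exact d.mul_Xi_mul_mem_T₀ hN hS ha (mul_mem (d.C_le_M _ hc) hb)
  · rw [mul_assoc]; exact d.mul_e_mul_mem_T₀ hc (mul_mem hx hb)

theorem X_mem_T₀ : d.X (m + 1) ∈ d.T₀ (m + 1) := by
  have h1 := d.mul_Xi_mul_mem_T₀ hN hS (one_mem _) (one_mem _)
  have h2 := d.mul_e_mul_mem_T₀ (n := m + 1) (one_mem _) (one_mem _)
  rw [one_mul, mul_one] at h1 h2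
  rw [d.X_eq]
  exact sub_mem (add_mem h1 (smul_mem _ _ (d.mem_T₀ (one_mem _)))) (smul_mem _ _ h2)

theorem Xi_mul_X_mem_T₀ {b : B} (hb : b ∈ d.A (m + 1)) :
    d.Xi (m + 1) * (b * d.X (m + 1)) ∈ d.T₀ (m + 1) := by
  have hl {a : B} (ha : a ∈ d.A m) : a ∈ d.A (m + 1) := d.A_mono (by omega) ha
  rw [← mem_comap_lr (R := R)]
  refine d.M_succ_le_of_mem hS (fun a ha => ?_) (fun a ha => ?_) (fun hm a ha c hc => ?_)
    (fun hm a ha c hc => ?_) hb <;> rw [mem_comap_lr]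
  · rw [d.A_X (by omega) hN ha, d.Xi_mul_X_assoc]
    exact d.mem_T₀ (hl ha)
  · rw [show d.Xi (m + 1) * (a * d.Ypi (m + 1) * d.X (m + 1)) =
        a * (d.Xi (m + 1) * d.Ypi (m + 1) * d.X (m + 1)) by
      rw [mul_assoc a, ← mul_assoc, ← d.A_Xi (by omega) hN ha]; simp only [mul_assoc]]
    refine d.A_mul_T₀ (hl ha) ?_
    rw [d.X_eq, mul_sub, mul_add, mul_smul_comm, mul_smul_comm, mul_one,
      d.Xi_Ypi_e (by omega) hN, ← d.Ypi_succ (by omega)]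
    have h1 := d.mul_mem_T₀ (one_mem _) (d.Ypi_mem_C (m + 1))
    have h2 := d.mul_Xi_mul_mem_T₀ hN hS (one_mem _) (d.Ypi_mem_A le_rfl)
    have h3 := d.mul_e_mul_mem_T₀ (d.Yp_mem_A (le_refl (m + 1))) (one_mem _)
    rw [one_mul] at h1 h2
    rw [mul_one] at h3
    exact sub_mem (add_mem h1 (smul_mem _ _ h2)) (smul_mem _ _ h3)
  · have hb := d.swap_Xi (d.XX_X' hm hN)
    have hb' : d.Xi (m + 1) * d.Xi m * d.X (m + 1) = d.X m * d.Xi (m + 1) * d.Xi m := by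
      calc _ = d.Xi (m + 1) * (d.Xi m * (d.X (m + 1) * d.X m)) * d.Xi m := by
            simp only [mul_assoc, d.X_mul_Xi, mul_one]
        _ = _ := by rw [← hb]; simp only [mul_assoc, d.Xi_mul_X_assoc]
    rw [show d.Xi (m + 1) * (a * d.Xi m * c * d.X (m + 1)) =
        a * (d.Xi (m + 1) * d.Xi m * d.X (m + 1)) * c by
      rw [mul_assoc _ c, d.A_X (by omega) hN hc, mul_assoc a, mul_assoc a, ← mul_assoc,
        ← d.A_Xi (by omega) hN ha]
      simp only [mul_assoc]]
    rw [hb', show a * (d.X m * d.Xi (m + 1) * d.Xi m) * c =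
      (a * d.X m) * d.Xi (m + 1) * (d.Xi m * c) by simp only [mul_assoc]]
    exact d.mul_Xi_mul_mem_T₀ hN hS (mul_mem (hl ha) (d.X_mem_A hm (by omega)))
      (mul_mem (d.Xi_mem_A hm (by omega)) (hl hc))
  · rw [show d.Xi (m + 1) * (a * d.e m * c * d.X (m + 1)) =
        a * (d.Xi (m + 1) * d.e m) * d.X (m + 1) * c by
      rw [mul_assoc _ c, d.A_X (by omega) hN hc, mul_assoc a, mul_assoc a, ← mul_assoc,
        ← d.A_Xi (by omega) hN ha]
      simp only [mul_assoc]]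
    rw [d.Xi_succ_e hm hN, show a * (d.X m * (d.e (m + 1) * d.e m)) * d.X (m + 1) * c =
      (a * d.X m) * ((d.e (m + 1) * d.e m) * d.X (m + 1)) * c by simp only [mul_assoc],
      ← d.e_succ_Xi hm hN, show a * d.X m * (d.e (m + 1) * d.Xi m) * c =
      a * d.X m * d.e (m + 1) * (d.Xi m * c) by simp only [mul_assoc]]
    exact d.mul_e_mul_mem_T₀ (mul_mem (hl ha) (d.X_mem_A hm (by omega)))
      (mul_mem (d.Xi_mem_A hm (by omega)) (hl hc))

theorem e_mul_X_mem_T₀ {b : B} (hb : b ∈ d.A (m + 1)) :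
    d.e (m + 1) * (b * d.X (m + 1)) ∈ d.T₀ (m + 1) := by
  have hl {a : B} (ha : a ∈ d.A m) : a ∈ d.A (m + 1) := d.A_mono (by omega) ha
  have he {a : B} (ha : a ∈ d.A (m + 1)) : a * d.e (m + 1) ∈ d.T₀ (m + 1) := by
    simpa using d.mul_e_mul_mem_T₀ ha (one_mem _)
  have he' {a : B} (ha : a ∈ d.A (m + 1)) : d.e (m + 1) * a ∈ d.T₀ (m + 1) := by
    simpa using d.mul_e_mul_mem_T₀ (one_mem _) ha
  rw [← mem_comap_lr (R := R)]
  refine d.M_succ_le_of_mem hS (fun a ha => ?_) (fun a ha => ?_) (fun hm a ha c hc => ?_)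
    (fun hm a ha c hc => ?_) hb <;> rw [mem_comap_lr]
  · rw [d.A_X (by omega) hN ha, ← mul_assoc, d.e_X _ (by omega) hN, smul_mul_assoc]
    exact smul_mem _ _ (he' (hl ha))
  · rw [show d.e (m + 1) * (a * d.Ypi (m + 1) * d.X (m + 1)) =
        a * (d.e (m + 1) * d.Ypi (m + 1) * d.X (m + 1)) by
      rw [mul_assoc a, ← mul_assoc, ← d.A_e (by omega) hN ha]; simp only [mul_assoc]]
    refine d.A_mul_T₀ (hl ha) ?_
    obtain ⟨x, hx, hxe⟩ := d.e_Ypi_e (k := m + 1) (by omega) hN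
    rw [d.X_eq, mul_sub, mul_add, mul_smul_comm, mul_smul_comm, mul_one, hxe,
      d.e_Ypi_Xi (by omega) hN]
    exact sub_mem (add_mem (he' (d.Yp_mem_A le_rfl)) (smul_mem _ _ (he' (d.Ypi_mem_A le_rfl))))
      (smul_mem _ _ (he (d.A_mono (by omega) hx)))
  · rw [show d.e (m + 1) * (a * d.Xi m * c * d.X (m + 1)) =
        a * (d.e (m + 1) * d.Xi m * d.X (m + 1)) * c by
      rw [mul_assoc _ c, d.A_X (by omega) hN hc, mul_assoc a, mul_assoc a, ← mul_assoc,
        ← d.A_e (by omega) hN ha]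
      simp only [mul_assoc]]
    refine d.T₀_mul_A hN hS (d.A_mul_T₀ (hl ha) ?_) (hl hc)
    rw [d.X_eq, mul_sub, mul_add, mul_smul_comm, mul_smul_comm, mul_one, d.e_Xi_e m hm hN,
      ← d.ee_down_right' hm hN]
    exact sub_mem (add_mem (he' (d.e_mem_A hm (by omega)))
      (smul_mem _ _ (he' (d.Xi_mem_A hm (by omega)))))
      (smul_mem _ _ (smul_mem _ _ (by simpa using he (one_mem _))))
  · rw [show d.e (m + 1) * (a * d.e m * c * d.X (m + 1)) =
        a * (d.e (m + 1) * d.e m * d.X (m + 1)) * c by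
      rw [mul_assoc _ c, d.A_X (by omega) hN hc, mul_assoc a, mul_assoc a, ← mul_assoc,
        ← d.A_e (by omega) hN ha]
      simp only [mul_assoc]]
    refine d.T₀_mul_A hN hS (d.A_mul_T₀ (hl ha) ?_) (hl hc)
    rw [← d.e_succ_Xi hm hN]
    exact he' (d.Xi_mem_A hm (by omega))

theorem T₀_mul_X {t : B} (ht : t ∈ d.T₀ (m + 1)) : t * d.X (m + 1) ∈ d.T₀ (m + 1) := by
  refine d.T₀_le (W := (d.T₀ (m + 1)).comap (LinearMap.mulRight R (d.X (m + 1))))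
    (fun a ha c hc => ?_) (fun c hc x hx => ?_) ht <;> rw [mem_comap, LinearMap.mulRight_apply]
  · rw [mul_assoc]
    refine d.A_mul_T₀ ha ?_
    have : c ∈ (d.T₀ (m + 1)).comap (LinearMap.mulRight R (d.X (m + 1))) := by
      refine d.C_succ_le ?_ ?_ (fun c hc => ?_) hc <;> rw [mem_comap, LinearMap.mulRight_apply]
      · rw [one_mul]; exact d.X_mem_T₀ hN hS
      · rw [d.Ypi_succ (by omega), mul_assoc, d.Xi_mul_X, mul_one]
        simpa using d.mul_Xi_mul_mem_T₀ hN hS (one_mem _) (d.Ypi_mem_A le_rfl)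
      · rw [mul_assoc]; exact d.Xi_mul_X_mem_T₀ hN hS (d.C_le_M _ hc)
    exact this
  · rw [mul_assoc, mul_assoc]
    exact d.A_mul_T₀ hc (d.e_mul_X_mem_T₀ hN hS hx)

theorem T₀_mul_Xi {t : B} (ht : t ∈ d.T₀ (m + 1)) : t * d.Xi (m + 1) ∈ d.T₀ (m + 1) := by
  have h1 := d.T₀_mul_X hN hS ht
  rw [d.Xi_eq, d.e_eq_sq (by omega) hN, mul_add, mul_sub, mul_smul_comm, mul_smul_comm,
    mul_smul_comm, mul_sub, mul_add, mul_one, mul_smul_comm, ← mul_assoc]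
  exact add_mem (sub_mem h1 (smul_mem _ _ ht)) (smul_mem _ _ (smul_mem _ _
    (sub_mem (add_mem ht (smul_mem _ _ h1)) (d.T₀_mul_X hN hS h1))))

theorem M_le_T₀ : d.M (m + 2) ≤ d.T₀ (m + 1) := by
  refine d.M_le_of_mul_mem (d.mem_T₀ (one_mem _))
    (fun _ t ht => d.T₀_mul_A hN hS ht (d.Yp_mem_A (j := 1) (by omega)))
    (fun _ t ht => d.T₀_mul_A hN hS ht (d.Ypi_mem_A (j := 1) (by omega)))
    (fun i h1 h2 t ht => ?_) (fun i h1 h2 t ht => ?_) <;>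
    obtain h | rfl : i < m + 1 ∨ i = m + 1 := by omega
  · exact d.T₀_mul_A hN hS ht (d.X_mem_A h1 h)
  · exact d.T₀_mul_X hN hS ht
  · exact d.T₀_mul_A hN hS ht (d.Xi_mem_A h1 h)
  · exact d.T₀_mul_Xi hN hS ht

end

end Step

section Chains

open Submodule

/-- The product `X_i X_{i+1} ⋯ X_{j-1}`. -/
def Xc (i : ℕ) : ℕ → B
  | 0 => 1
  | (j + 1) => if i ≤ j then Xc i j * d.X j else 1

/-- The product `e_i e_{i+1} ⋯ e_{j-1}`. -/
def Ec (i : ℕ) : ℕ → B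
  | 0 => 1
  | (j + 1) => if i ≤ j then Ec i j * d.e j else 1

theorem Xc_self : ∀ i, d.Xc i i = 1
  | 0 => rfl
  | (i + 1) => if_neg (by omega)

theorem Ec_self : ∀ i, d.Ec i i = 1
  | 0 => rfl
  | (i + 1) => if_neg (by omega)

theorem Xc_succ {i j : ℕ} (h : i ≤ j) : d.Xc i (j + 1) = d.Xc i j * d.X j := if_pos h

theorem Ec_succ {i j : ℕ} (h : i ≤ j) : d.Ec i (j + 1) = d.Ec i j * d.e j := if_pos h

theorem Ec_mem_A {i j : ℕ} (h1 : 1 ≤ i) (h2 : i ≤ j) : d.Ec i j ∈ d.A j := by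
  induction j, h2 using Nat.le_induction with
  | base => rw [Ec_self]; exact one_mem _
  | succ j hj ih =>
    rw [d.Ec_succ hj]
    exact mul_mem (d.A_mono (by omega) ih) (d.e_mem_A (by omega) (by omega))

theorem A_Xc {k i j : ℕ} (h1 : k < i) (h2 : i ≤ j) (h3 : j ≤ N) {a : B} (ha : a ∈ d.A k) :
    a * d.Xc i j = d.Xc i j * a := by
  induction j, h2 using Nat.le_induction with
  | base => rw [Xc_self, mul_one, one_mul]
  | succ j hj ih =>
    rw [d.Xc_succ hj, ← mul_assoc, ih (by omega), mul_assoc, d.A_X (by omega) (by omega) ha,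
      mul_assoc]

theorem mul_Xc_mem_D {i j : ℕ} (h : i ≤ j) {c : B} (hc : c ∈ d.D i) :
    c * d.Xc i j ∈ d.D j := by
  induction j, h using Nat.le_induction with
  | base => rwa [Xc_self, mul_one]
  | succ j hj ih => rw [d.Xc_succ hj, ← mul_assoc]; exact d.mul_X_mem_D ih

theorem e_mul_Xc {i j : ℕ} (h1 : 1 ≤ i) (h2 : i + 1 ≤ j) (h3 : j ≤ N) :
    ∃ a ∈ d.A (j - 1), d.e i * d.Xc (i + 1) j = d.Ec i j * a := by
  induction j, h2 using Nat.le_induction with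
  | base =>
    exact ⟨1, one_mem _, by rw [Xc_self, d.Ec_succ le_rfl, Ec_self, one_mul]⟩
  | succ j hj ih =>
    obtain ⟨a, ha, h⟩ := ih (by omega)
    obtain ⟨j, rfl⟩ := Nat.exists_eq_add_of_le' (show 1 ≤ j by omega)
    rw [Nat.add_sub_cancel] at ha ⊢
    refine ⟨d.Xi j * a, mul_mem (d.Xi_mem_A (by omega) (by omega)) (d.A_mono (by omega) ha), ?_⟩
    rw [d.Xc_succ hj, ← mul_assoc, h, mul_assoc, d.A_X (by omega) (by omega) ha, ← mul_assoc,
      d.Ec_succ (by omega), mul_assoc _ (d.e j), d.e_X_succ (by omega) (by omega),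
      d.Ec_succ (by omega), d.Ec_succ (by omega)]
    simp only [mul_assoc]

/-- An auxiliary submodule, absorbing `a * E_i ⋯ e_{p+1} * y * e_p` for `y ∈ d.D p`. -/
def U (i p : ℕ) : Submodule R B :=
  d.D (p + 2) * d.M (p + 1) ⊔ d.M i * span R {d.Xc i (p + 2)} * d.M (p + 1)

theorem D_mul_mem_U {i p : ℕ} {y x : B} (hy : y ∈ d.D (p + 2)) (hx : x ∈ d.A (p + 1)) :
    y * x ∈ d.U i p :=
  mem_sup_left (mul_mem_mul (N := d.M (p + 1)) hy hx)

theorem Xc_mul_mem_U {i p : ℕ} {a x : B} (ha : a ∈ d.A i) (hx : x ∈ d.A (p + 1)) :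
    a * d.Xc i (p + 2) * x ∈ d.U i p :=
  mem_sup_right (mul_span_mul_mem (P := d.M i) (Q := d.M (p + 1)) ha _ hx)

theorem U_le {i p : ℕ} {W : Submodule R B}
    (h1 : ∀ y ∈ d.D (p + 2), ∀ x ∈ d.A (p + 1), y * x ∈ W)
    (h2 : ∀ a ∈ d.A i, ∀ x ∈ d.A (p + 1), a * d.Xc i (p + 2) * x ∈ W) : d.U i p ≤ W :=
  sup_le (mul_le.2 h1) (mul_span_mul_le h2)

theorem Ec_D_e_mem_U {i p : ℕ} (h1 : 1 ≤ i) (h2 : i ≤ p + 1) (h3 : p + 1 < N) {a y : B}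
    (ha : a ∈ d.A i) (hy : y ∈ d.D p) : a * d.Ec i (p + 2) * y * d.e p ∈ d.U i p := by
  have hpos : ∀ {p : ℕ} {a y : B} {W : Submodule R B}, y ∈ d.D p →
      (1 ≤ p → a * y * d.e p ∈ W) → a * y * d.e p ∈ W := by
    intro p a y W hy h
    rcases Nat.eq_zero_or_pos p with rfl | hp
    · rw [(mem_bot R).1 hy, mul_zero, zero_mul]; exact zero_mem _
    · exact h hp
  induction p generalizing a y with
  | zero => exact hpos hy (by omega)
  | succ p ih =>
    rcases Nat.lt_or_ge i (p + 2) with hi | hi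
    swap
    · obtain rfl : i = p + 2 := by omega
      have hy' := d.D_le_M _ hy
      have hX : d.Xc (p + 2) (p + 1 + 2) = d.X (p + 2) := by
        rw [d.Xc_succ le_rfl, Xc_self, one_mul]
      rw [d.Ec_succ le_rfl, Ec_self, one_mul, mul_assoc a, ← d.A_e (by omega) h3 hy',
        show a * (y * d.e (p + 2)) * d.e (p + 1) = a * y * (d.e (p + 2) * d.e (p + 1)) by
          simp only [mul_assoc], d.ee_down_left (by omega) h3,
        show a * y * (d.X (p + 1) * d.X (p + 2) * d.e (p + 1)) =
          (a * y * d.X (p + 1)) * d.X (p + 2) * d.e (p + 1) by simp only [mul_assoc], ← hX]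
      exact d.Xc_mul_mem_U (mul_mem (mul_mem ha (d.A_mono (by omega) hy'))
        (d.X_mem_A (by omega) (by omega))) (d.e_mem_A (by omega) (by omega))
    · have hE : d.Ec i (p + 3) = d.Ec i (p + 1) * d.e (p + 1) * d.e (p + 2) := by
        rw [d.Ec_succ (by omega), d.Ec_succ (by omega)]
      have hEe : d.Ec i (p + 3) * d.e (p + 1) = d.Ec i (p + 2) := by
        rw [hE, mul_assoc, mul_assoc, ← mul_assoc (d.e _), d.e_up_down (by omega) h3,
          ← d.Ec_succ (by omega)]
      have hmem : a * d.Ec i (p + 2) ∈ d.A (p + 2) :=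
        mul_mem (d.A_mono (by omega) ha) (d.Ec_mem_A h1 (by omega))
      rw [mul_assoc, ← mem_comap_lr (R := R)]
      refine d.D_succ_le ?_ ?_ (fun y hy => ?_) hy <;> rw [mem_comap_lr]
      · rw [one_mul, mul_assoc, hEe]
        simpa using d.D_mul_mem_U (d.one_mem_D _) hmem
      · rw [hE, show a * (d.Ec i (p + 1) * d.e (p + 1) * d.e (p + 2)) *
            (d.Yp (p + 1) * d.e (p + 1)) = a * d.Ec i (p + 1) *
            (d.e (p + 1) * d.e (p + 2) * d.Yp (p + 1)) * d.e (p + 1) by simp only [mul_assoc],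
          d.ee_Yp (by omega) h3]
        have hc := d.A_Yp (k := p + 2) (j := p + 3) (by omega) (by omega)
          (mul_mem (d.A_mono (by omega) ha)
            (d.A_mono (by omega) (d.Ec_mem_A h1 (show i ≤ p + 1 by omega))))
        rw [← mul_assoc, hc, mul_assoc, mul_assoc, d.e_up_down (by omega) h3, mul_assoc,
          ← d.Ec_succ (by omega)]
        exact d.D_mul_mem_U (d.Yp_mem_D _) hmem
      · rcases Nat.eq_zero_or_pos p with rfl | hp
        · rw [(mem_bot R).1 hy, zero_mul, zero_mul, mul_zero]; exact zero_mem _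
        have hy' := d.D_le_M _ hy
        have hc1 := d.A_e (i := p + 1) (by omega) (by omega) hy'
        have hc2 := d.A_e (i := p + 2) (by omega) (by omega) hy'
        have hcX := d.A_e (k := p + 1) (i := p + 2) (by omega) (by omega)
          (d.X_mem_A hp (by omega))
        have key : a * d.Ec i (p + 3) * (y * d.X p * d.e (p + 1)) =
            a * d.Ec i (p + 2) * y * d.e p * (d.X (p + 2) * d.e (p + 1)) := by
          calc _ = a * d.Ec i (p + 1) * d.e (p + 1) * (d.e (p + 2) * y) * d.X p * d.e (p + 1) := by
                rw [hE]; simp only [mul_assoc]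
            _ = a * d.Ec i (p + 1) * (d.e (p + 1) * y) * (d.e (p + 2) * d.X p) * d.e (p + 1) := by
                rw [← hc2]; simp only [mul_assoc]
            _ = a * d.Ec i (p + 1) * y * d.e (p + 1) * d.X p * (d.e (p + 2) * d.e (p + 1)) := by
                rw [← hc1, ← hcX]; simp only [mul_assoc]
            _ = a * d.Ec i (p + 1) * y * (d.e (p + 1) * d.e p) * (d.X (p + 2) * d.e (p + 1)) := by
                rw [d.ee_down_left (by omega) h3, d.ee_down_right hp (by omega)]
                simp only [mul_assoc]
            _ = a * d.Ec i (p + 1) * (y * d.e (p + 1)) * d.e p * (d.X (p + 2) * d.e (p + 1)) := by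
                simp only [mul_assoc]
            _ = _ := by rw [hc1, d.Ec_succ (j := p + 1) (by omega)]; simp only [mul_assoc]
        rw [key]
        refine d.U_le (W := (d.U i (p + 1)).comap (LinearMap.mulRight R _)) (fun u hu x hx => ?_)
          (fun u hu x hx => ?_) (ih (by omega) (by omega) ha hy) <;>
          (rw [mem_comap, LinearMap.mulRight_apply]
           have hxX := d.A_X (i := p + 2) (by omega) h3 hx
           have hx' := mul_mem (d.A_mono (show p + 1 ≤ p + 2 by omega) hx)
             (d.e_mem_A (i := p + 1) (k := p + 2) (by omega) (by omega)))
        · rw [show u * x * (d.X (p + 2) * d.e (p + 1)) = u * d.X (p + 2) * (x * d.e (p + 1)) by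
            rw [mul_assoc, ← mul_assoc x, hxX]; simp only [mul_assoc]]
          exact d.D_mul_mem_U (d.mul_X_mem_D hu) hx'
        · rw [show u * d.Xc i (p + 2) * x * (d.X (p + 2) * d.e (p + 1)) =
              u * d.Xc i (p + 3) * (x * d.e (p + 1)) by
            rw [mul_assoc _ x, ← mul_assoc x, hxX, d.Xc_succ (j := p + 2) (by omega)]
            simp only [mul_assoc]]
          exact d.Xc_mul_mem_U hu hx'

theorem Ec_mul_mem_T {n : ℕ} (hN : n + 1 < N) (hS : d.M (n + 1) ≤ d.T n) {i : ℕ} (h1 : 1 ≤ i)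
    (h2 : i ≤ n)
    (hK : ∀ a ∈ d.A i, ∀ b ∈ d.A (n + 1),
      a * d.Xc i (n + 1) * d.e (n + 1) * b ∈ d.T (n + 1)) :
    ∀ a ∈ d.A i, ∀ b ∈ d.A (n + 1), a * d.Ec i (n + 2) * b ∈ d.T (n + 1) := by
  intro a ha b hb
  have hl {x : B} (hx : x ∈ d.A n) : x ∈ d.A (n + 1) := d.A_mono (by omega) hx
  have haE : a * d.Ec i (n + 1) ∈ d.A (n + 1) :=
    mul_mem (d.A_mono (by omega) ha) (d.Ec_mem_A h1 (by omega))
  have hb' : d.Xi n * b ∈ d.A (n + 1) := mul_mem (d.Xi_mem_A (by omega) (by omega)) hb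
  rw [show a * d.Ec i (n + 2) * b = a * d.Ec i (n + 1) * d.Xi (n + 1) * (d.Xi n * b) by
    rw [d.Ec_succ (by omega), d.Ec_succ (by omega), mul_assoc _ (d.e n),
      d.ee_up_right' (by omega) hN]
    simp only [mul_assoc]]
  refine d.T_le (W := (d.T (n + 1)).comap (LinearMap.mulLeft R _)) (fun x hx c hc => ?_)
    (fun y hy x hx => ?_) (hS hb') <;> rw [mem_comap, LinearMap.mulLeft_apply]
  · have hxX := d.A_Xi (i := n + 1) (by omega) hN hx
    rw [show a * d.Ec i (n + 1) * d.Xi (n + 1) * (x * c) =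
        a * d.Ec i (n + 1) * x * (d.Xi (n + 1) * c) by
      rw [mul_assoc _ _ (x * c), ← mul_assoc _ x, ← hxX]; simp only [mul_assoc]]
    exact d.mul_mem_T (mul_mem haE (hl hx)) (d.Xi_mul_mem_C hc)
  · have hyX := d.A_Xi (i := n + 1) (by omega) hN (d.D_le_M n hy)
    have hmem : a * d.Ec i n ∈ d.A n := mul_mem (d.A_mono (by omega) ha) (d.Ec_mem_A h1 h2)
    rw [show a * d.Ec i (n + 1) * d.Xi (n + 1) * (y * d.e n * x) =
        a * d.Ec i (n + 1) * (y * (d.Xi (n + 1) * d.e n * x)) by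
      calc _ = a * d.Ec i (n + 1) * (d.Xi (n + 1) * y) * d.e n * x := by simp only [mul_assoc]
        _ = _ := by rw [← hyX]; simp only [mul_assoc]]
    rw [← mem_comap_lr (R := R)]
    obtain ⟨p, rfl⟩ := Nat.exists_eq_add_of_le' (show 1 ≤ n by omega)
    refine d.D_succ_le ?_ ?_ (fun y hy => ?_) hy <;> rw [mem_comap_lr]
    · rw [one_mul, d.Ec_succ h2, show a * (d.Ec i (p + 1) * d.e (p + 1)) *
          (d.Xi (p + 2) * d.e (p + 1) * x) =
          a * d.Ec i (p + 1) * (d.e (p + 1) * d.Xi (p + 2) * d.e (p + 1)) * x by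
        simp only [mul_assoc], d.e_Xi_succ_e (by omega) hN, mul_smul_comm, smul_mul_assoc]
      refine smul_mem _ _ ?_
      have := d.mul_mem_T (mul_mem (mul_mem (hl hmem) (d.e_mem_A (i := p + 1) (by omega)
        (by omega))) (hl hx)) (d.one_mem_C (p + 2))
      simpa using this
    · have hYx := d.A_Ypi (j := p + 3) (by omega) (by omega) hx
      rw [d.Ec_succ h2, show a * (d.Ec i (p + 1) * d.e (p + 1)) * (d.Yp (p + 1) *
          (d.Xi (p + 2) * d.e (p + 1) * x)) = a * d.Ec i (p + 1) *
          (d.e (p + 1) * d.Yp (p + 1) * d.Xi (p + 2) * d.e (p + 1)) * x by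
        simp only [mul_assoc], d.e_Yp_Xi_e (by omega) hN, mul_assoc, mul_assoc (d.e _), ← hYx,
        ← mul_assoc, ← mul_assoc]
      exact d.mul_mem_T (mul_mem (mul_mem (hl hmem) (d.e_mem_A (i := p + 1) (by omega)
        (by omega))) (hl hx)) (d.Ypi_mem_C (p + 2))
    · rcases Nat.eq_zero_or_pos p with rfl | hp
      · rw [(mem_bot R).1 hy, zero_mul, zero_mul, mul_zero]; exact zero_mem _
      have hy1 := d.A_e (i := p + 1) (by omega) (by omega) (d.D_le_M p hy)
      have hE : d.Ec i (p + 2) = d.Ec i (p + 1) * d.e (p + 1) := d.Ec_succ h2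
      have key : a * d.Ec i (p + 2) * (y * d.X p * (d.Xi (p + 2) * d.e (p + 1) * x)) =
          a * d.Ec i (p + 2) * y * d.e p * (d.e (p + 2) * (d.e (p + 1) * x)) := by
        calc _ = a * d.Ec i (p + 1) * (d.e (p + 1) * y) * d.X p *
              (d.Xi (p + 2) * d.e (p + 1)) * x := by
              rw [hE]; simp only [mul_assoc]
          _ = a * d.Ec i (p + 1) * y * (d.e (p + 1) * d.X p * d.X (p + 1)) *
              (d.e (p + 2) * d.e (p + 1)) * x := by
              rw [← hy1, d.Xi_succ_e (by omega) hN]; simp only [mul_assoc]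
          _ = a * d.Ec i (p + 1) * (y * d.e (p + 1)) * d.e p *
              (d.e (p + 2) * d.e (p + 1)) * x := by
              rw [← d.ee_down_right hp (by omega)]; simp only [mul_assoc]
          _ = _ := by rw [hy1, hE]; simp only [mul_assoc]
      rw [key]
      have hx' : d.e (p + 1) * x ∈ d.A (p + 2) := mul_mem (d.e_mem_A (by omega) (by omega)) (hl hx)
      refine d.U_le (W := (d.T (p + 2)).comap (LinearMap.mulRight R _)) (fun u hu z hz => ?_)
        (fun u hu z hz => ?_) (d.Ec_D_e_mem_U h1 h2 (by omega) ha hy) <;>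
        (rw [mem_comap, LinearMap.mulRight_apply, mul_assoc _ z, ← mul_assoc z,
          d.A_e (by omega) hN hz, mul_assoc (d.e _), ← mul_assoc]
         have hz' := mul_mem (hl hz) hx')
      · exact d.mul_e_mul_mem_T hu hz'
      · exact hK u hu _ hz'

theorem Xc_e_mul_mem_T {n : ℕ} (hN : n < N) (hS : ∀ j < n, d.M (j + 1) ≤ d.T j)
    (hS' : ∀ j < n, d.M (j + 1) ≤ d.T' j) {i : ℕ} (h1 : 1 ≤ i) (h2 : i ≤ n) :
    ∀ a ∈ d.A i, ∀ b ∈ d.A n, a * d.Xc i n * d.e n * b ∈ d.T n := by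
  have step : ∀ i, i + 1 ≤ n → (1 ≤ i → ∀ a ∈ d.A i, ∀ b ∈ d.A n,
      a * d.Ec i (n + 1) * b ∈ d.T n) →
      ∀ a ∈ d.A (i + 1), ∀ b ∈ d.A n, a * d.Xc (i + 1) n * d.e n * b ∈ d.T n := by
    intro i hi hG a ha b hb
    have hl {a : B} (ha : a ∈ d.A i) : a ∈ d.A n := d.A_mono (by omega) ha
    rw [mul_assoc, mul_assoc]
    refine d.T'_le (W := (d.T n).comap (LinearMap.mulRight R _)) (fun c hc x hx => ?_)
      (fun x hx c hc => ?_) (hS' i hi ha) <;> rw [mem_comap, LinearMap.mulRight_apply]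
    · have hcX := d.A_Xc (Nat.lt_succ_self i) hi hN.le hx
      have hce := d.A_e hi hN hx
      rw [show c * x * (d.Xc (i + 1) n * (d.e n * b)) = c * d.Xc (i + 1) n * d.e n * (x * b) by
        rw [mul_assoc c, ← mul_assoc x, hcX, mul_assoc (d.Xc _ _), ← mul_assoc x, hce]
        simp only [mul_assoc]]
      exact d.mul_e_mul_mem_T (d.mul_Xc_mem_D hi hc) (mul_mem (hl hx) hb)
    · rcases Nat.eq_zero_or_pos i with rfl | h0
      · rw [(mem_bot R).1 hc, mul_zero, zero_mul]; exact zero_mem _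
      have hc' := d.C_le_M i hc
      have hcX := d.A_Xc (Nat.lt_succ_self i) hi hN.le hc'
      have hce := d.A_e hi hN hc'
      obtain ⟨z, hz, hez⟩ := d.e_mul_Xc h0 hi hN.le
      have hzc := d.A_e (by omega) hN hz
      rw [show x * d.e i * c * (d.Xc (i + 1) n * (d.e n * b)) =
          x * d.Ec i (n + 1) * (z * (c * b)) by
        calc _ = x * d.e i * (c * d.Xc (i + 1) n) * d.e n * b := by simp only [mul_assoc]
          _ = x * (d.e i * d.Xc (i + 1) n) * (c * d.e n) * b := by
            rw [hcX]; simp only [mul_assoc]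
          _ = x * d.Ec i n * (z * d.e n) * c * b := by rw [hez, hce]; simp only [mul_assoc]
          _ = _ := by rw [hzc, d.Ec_succ (by omega)]; simp only [mul_assoc]]
      exact hG h0 x hx _ (mul_mem (d.A_mono (by omega) hz) (mul_mem (hl hc') hb))
  induction i, h1 using Nat.le_induction with
  | base => exact step 0 h2 (by omega)
  | succ i hi ih =>
    refine step i h2 fun _ => ?_
    obtain ⟨n, rfl⟩ := Nat.exists_eq_add_of_le' (show 1 ≤ n by omega)
    exact d.Ec_mul_mem_T hN (hS n (by omega)) hi (by omega) (ih (by omega))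

theorem M_succ_le_T_of_lt {n : ℕ} (hN : n < N) (hS : ∀ j < n, d.M (j + 1) ≤ d.T j)
    (hS' : ∀ j < n, d.M (j + 1) ≤ d.T' j) : d.M (n + 1) ≤ d.T n := by
  rcases n with _ | m
  · exact d.M_one_le
  · refine (d.M_le_T₀ hN (hS m (by omega))).trans (d.T₀_le (fun a ha c hc => d.mul_mem_T ha hc)
      (fun a ha b hb => ?_))
    have := d.Xc_e_mul_mem_T hN hS hS' (i := m + 1) (by omega) le_rfl a ha b hb
    rwa [Xc_self, mul_one] at this

end Chains

theorem M_succ_le_T (n : ℕ) (hN : n < N) : d.M (n + 1) ≤ d.T n := by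
  induction n using Nat.strong_induction_on generalizing B with
  | _ n ih =>
    exact d.M_succ_le_T_of_lt hN (fun j hj => ih j hj d (by omega))
      (fun j hj => d.le_T'_of_op (ih j hj d.op (by omega)))

section Spanning

open Submodule Finset
open scoped Classical Pointwise

/-- A finite set spanning `d.C k`. -/
noncomputable def Cset : ℕ → Finset B
  | 0 => ∅
  | (k + 1) => {1, d.Ypi (k + 1)} ∪ {d.Xi k} * Cset k

/-- A finite set spanning `d.D k`. -/
noncomputable def Dset : ℕ → Finset B
  | 0 => ∅
  | (k + 1) => {1, d.Yp (k + 1)} ∪ Dset k * {d.X k}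

/-- A finite set spanning `d.M k` for `k ≤ N`. -/
noncomputable def Bset : ℕ → Finset B
  | 0 => {1}
  | (k + 1) => Bset k * d.Cset (k + 1) ∪ d.Dset k * {d.e k} * Bset k

theorem card_Cset_le : ∀ k, #(d.Cset k) ≤ 2 * k
  | 0 => le_rfl
  | (k + 1) => by
    have h1 : #({d.Xi k} * d.Cset k) ≤ #(d.Cset k) := by
      simpa using card_mul_le (s := {d.Xi k}) (t := d.Cset k)
    have h2 := card_le_two (a := (1 : B)) (b := d.Ypi (k + 1))
    have h3 := card_union_le {1, d.Ypi (k + 1)} ({d.Xi k} * d.Cset k)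
    have h4 := card_Cset_le k
    rw [Cset]
    omega

theorem card_Dset_le : ∀ k, #(d.Dset k) ≤ 2 * k
  | 0 => le_rfl
  | (k + 1) => by
    have h1 : #(d.Dset k * {d.X k}) ≤ #(d.Dset k) := by
      simpa using card_mul_le (s := d.Dset k) (t := {d.X k})
    have h2 := card_le_two (a := (1 : B)) (b := d.Yp (k + 1))
    have h3 := card_union_le {1, d.Yp (k + 1)} (d.Dset k * {d.X k})
    have h4 := card_Dset_le k
    rw [Dset]
    omega

theorem card_Bset_le : ∀ k, #(d.Bset k) ≤ 2 ^ k * Nat.doubleFactorial (2 * k - 1)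
  | 0 => by simp [Bset]
  | (k + 1) => by
    have h1 := (card_mul_le (s := d.Bset k) (t := d.Cset (k + 1))).trans
      (Nat.mul_le_mul_left _ (d.card_Cset_le _))
    have h2 : #(d.Dset k * {d.e k} * d.Bset k) ≤ 2 * k * #(d.Bset k) := by
      refine card_mul_le.trans (Nat.mul_le_mul_right _ (card_mul_le.trans ?_))
      simpa using d.card_Dset_le k
    have h3 : Nat.doubleFactorial (2 * (k + 1) - 1) =
        (2 * k + 1) * Nat.doubleFactorial (2 * k - 1) := by
      rcases k with _ | k
      · rfl
      · exact Nat.doubleFactorial_add_two (2 * k + 1)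
    calc _ ≤ #(d.Bset k) * (2 * (k + 1)) + 2 * k * #(d.Bset k) :=
          (card_union_le _ _).trans (add_le_add h1 h2)
      _ = 2 * (2 * k + 1) * #(d.Bset k) := by ring
      _ ≤ 2 * (2 * k + 1) * (2 ^ k * Nat.doubleFactorial (2 * k - 1)) :=
          Nat.mul_le_mul_left _ (card_Bset_le k)
      _ = _ := by rw [h3]; ring

theorem C_le_span : ∀ k, d.C k ≤ span R (d.Cset k)
  | 0 => bot_le
  | (k + 1) => by
    rw [C, Cset, coe_union, span_union, coe_mul, coe_singleton, ← span_mul_span, one_eq_span,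
      ← span_union]
    refine sup_le_sup (span_mono ?_) (mul_le_mul_right (C_le_span k) _)
    simp [Set.pair_comm]

theorem D_le_span : ∀ k, d.D k ≤ span R (d.Dset k)
  | 0 => bot_le
  | (k + 1) => by
    rw [D, Dset, coe_union, span_union, coe_mul, coe_singleton, ← span_mul_span, one_eq_span,
      ← span_union]
    refine sup_le_sup (span_mono ?_) (mul_le_mul_left (D_le_span k) _)
    simp [Set.pair_comm]

theorem M_zero_le : d.M 0 ≤ 1 :=
  d.M_le_of_mul_mem (one_le.1 le_rfl) (by omega) (by omega) (by omega) (by omega)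

theorem M_le_span : ∀ k ≤ N, d.M k ≤ span R (d.Bset k)
  | 0, _ => d.M_zero_le.trans (by rw [Bset, coe_singleton, one_eq_span])
  | (k + 1), h => by
    refine (d.M_succ_le_T k h).trans ?_
    have ih := M_le_span k (by omega)
    rw [Bset, coe_union, span_union, coe_mul, coe_mul, coe_mul, coe_singleton, ← span_mul_span,
      ← span_mul_span, ← span_mul_span]
    exact sup_le_sup (mul_le_mul' ih (d.C_le_span _))
      (mul_le_mul' (mul_le_mul' (d.D_le_span _) le_rfl) ih)

end Spanning

section Form

/-- The subalgebra generated by `X_1, …, X_{k-1}`. -/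
def S (k : ℕ) : Subalgebra R B := Algebra.adjoin R {b | ∃ i, 1 ≤ i ∧ i < k ∧ b = d.X i}

theorem S_mono {k l : ℕ} (h : k ≤ l) : d.S k ≤ d.S l :=
  Algebra.adjoin_mono fun _ ⟨i, h1, h2, h3⟩ => ⟨i, h1, by omega, h3⟩

theorem X_mem_S {i k : ℕ} (h1 : 1 ≤ i) (h2 : i < k) : d.X i ∈ d.S k :=
  Algebra.subset_adjoin ⟨i, h1, h2, rfl⟩

theorem S_le_A (k : ℕ) : d.S k ≤ d.A k :=
  Algebra.adjoin_le fun _ ⟨_, h1, h2, h3⟩ => h3 ▸ d.X_mem_A h1 h2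

theorem e_mem_S {i k : ℕ} (h1 : 1 ≤ i) (h2 : i < k) (h3 : k ≤ N) : d.e i ∈ d.S k := by
  have hX := d.X_mem_S h1 h2
  rw [d.e_eq_sq h1 (by omega)]
  exact (d.S k).smul_mem (sub_mem (add_mem (one_mem _) ((d.S k).smul_mem hX _)) (mul_mem hX hX)) _

theorem Xi_mem_S {i k : ℕ} (h1 : 1 ≤ i) (h2 : i < k) (h3 : k ≤ N) : d.Xi i ∈ d.S k := by
  rw [d.Xi_eq]
  exact add_mem (sub_mem (d.X_mem_S h1 h2) ((d.S k).smul_mem (one_mem _) _))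
    ((d.S k).smul_mem (d.e_mem_S h1 h2 h3) _)

theorem unop_mem_S {k : ℕ} (h : k ≤ N) {b : Bᵐᵒᵖ} (hb : b ∈ d.op.S k) : b.unop ∈ d.S k := by
  suffices d.op.S k ≤ (d.S k).op from this hb
  refine Algebra.adjoin_le ?_
  rintro _ ⟨i, h1, h2, rfl⟩
  exact d.Xi_mem_S h1 h2 h

/-- `d.P n k b` means that `b` is a product of `k` factors `(Y'_i)⁻¹` with increasing
indices `i ≤ n`. -/
inductive P : ℕ → ℕ → B → Prop
  | one : P 0 0 1
  | skip {n k : ℕ} {b : B} : P n k b → P (n + 1) k b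
  | snoc {n k : ℕ} {b : B} : P n k b → P (n + 1) (k + 1) (b * d.Ypi (n + 1))

theorem P_mem_A {n k : ℕ} {b : B} (h : d.P n k b) : b ∈ d.A n := by
  induction h with
  | one => exact one_mem _
  | skip _ ih => exact d.A_mono (by omega) ih
  | snoc _ ih => exact mul_mem (d.A_mono (by omega) ih) (d.Ypi_mem_A le_rfl)

theorem exists_list_of_P {n k : ℕ} {b : B} (h : d.P n k b) :
    ∃ L : List ℕ, (∀ i ∈ L, 1 ≤ i ∧ i ≤ n) ∧ L.length = k ∧ b = (L.map d.Ypi).prod := by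
  induction h with
  | one => exact ⟨[], by simp⟩
  | skip _ ih =>
    obtain ⟨L, h1, h2, h3⟩ := ih
    exact ⟨L, fun i hi => ⟨(h1 i hi).1, (h1 i hi).2.trans (Nat.le_succ _)⟩, h2, h3⟩
  | @snoc n _ _ _ ih =>
    obtain ⟨L, h1, h2, h3⟩ := ih
    refine ⟨L ++ [n + 1], fun i hi => ?_, by simp [h2], by simp [h3]⟩
    rcases List.mem_append.1 hi with hi | hi
    · exact ⟨(h1 i hi).1, (h1 i hi).2.trans (Nat.le_succ _)⟩
    · rw [List.mem_singleton.1 hi]; omega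

theorem mem_Cset_succ {n : ℕ} {c : B} (hc : c ∈ d.Cset (n + 1)) :
    c = 1 ∨ c = d.Ypi (n + 1) ∨ ∃ c' ∈ d.Cset n, c = d.Xi n * c' := by
  simp only [Cset, Finset.mem_union, Finset.mem_insert, Finset.mem_singleton,
    Finset.mem_mul, or_assoc] at hc
  obtain h | h | ⟨_, rfl, c', h, rfl⟩ := hc
  exacts [Or.inl h, Or.inr (Or.inl h), Or.inr (Or.inr ⟨c', h, rfl⟩)]

theorem op_mem_Cset {c : B} : ∀ {n : ℕ}, c ∈ d.Dset n → MulOpposite.op c ∈ d.op.Cset n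
  | 0, h => by simp [Dset] at h
  | (n + 1), h => by
    simp only [Dset, Finset.mem_union, Finset.mem_insert, Finset.mem_singleton,
      Finset.mem_mul] at h
    simp only [Cset, op_Ypi, Finset.mem_union, Finset.mem_insert, Finset.mem_singleton,
      Finset.mem_mul]
    obtain (rfl | rfl) | ⟨c, hc, _, rfl, rfl⟩ := h
    · simp
    · simp
    · exact Or.inr ⟨_, rfl, _, op_mem_Cset hc, rfl⟩

theorem mem_C_of_mem_Cset {c : B} : ∀ {n : ℕ}, c ∈ d.Cset n → c ∈ d.C n
  | 0, h => by simp [Cset] at h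
  | (n + 1), h => by
    obtain rfl | rfl | ⟨c, hc, rfl⟩ := d.mem_Cset_succ h
    exacts [d.one_mem_C n, d.Ypi_mem_C n, d.Xi_mul_mem_C (mem_C_of_mem_Cset hc)]

theorem P_mul_Cset {n : ℕ} (hN : n < N) {k : ℕ} {b c : B} (hb : d.P n k b)
    (hc : c ∈ d.Cset (n + 1)) :
    ∃ s ∈ d.S (n + 1), ∃ l ≤ k + 1, ∃ b', d.P (n + 1) l b' ∧ b * c = s * b' := by
  induction n generalizing k b c with
  | zero =>
    obtain rfl | rfl | ⟨c, hc', rfl⟩ := d.mem_Cset_succ hc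
    · exact ⟨1, one_mem _, k, by omega, b, hb.skip, by rw [mul_one, one_mul]⟩
    · exact ⟨1, one_mem _, k + 1, le_rfl, _, hb.snoc, by rw [one_mul]⟩
    · simp [Cset] at hc'
  | succ n ih =>
    obtain rfl | rfl | ⟨c, hc', rfl⟩ := d.mem_Cset_succ hc
    · exact ⟨1, one_mem _, k, by omega, b, hb.skip, by rw [mul_one, one_mul]⟩
    · exact ⟨1, one_mem _, k + 1, le_rfl, _, hb.snoc, by rw [one_mul]⟩
    · cases hb with
      | skip hb =>
        obtain ⟨s, hs, l, hl, b', hb', h⟩ := ih (by omega) hb hc'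
        refine ⟨d.Xi (n + 1) * s, mul_mem (d.Xi_mem_S (by omega) (by omega) hN)
          (d.S_mono (by omega) hs), l, hl, b', hb'.skip, ?_⟩
        rw [← mul_assoc, d.A_Xi (by omega) hN (d.P_mem_A hb), mul_assoc, h, mul_assoc]
      | @snoc _ k b hb =>
        obtain ⟨s, hs, l, hl, b', hb', h⟩ := ih (by omega) hb hc'
        refine ⟨d.X (n + 1) * s, mul_mem (d.X_mem_S (by omega) (by omega))
          (d.S_mono (by omega) hs), l + 1, by omega, _, hb'.snoc, ?_⟩
        have hcA : c ∈ d.A (n + 1) := d.C_le_M _ (d.mem_C_of_mem_Cset hc')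
        have hX : d.Ypi (n + 1) * d.Xi (n + 1) = d.X (n + 1) * d.Ypi (n + 2) := by
          rw [d.Ypi_succ (k := n + 1) (by omega), mul_assoc, d.X_mul_Xi_assoc]
        calc b * d.Ypi (n + 1) * (d.Xi (n + 1) * c)
            = b * (d.Ypi (n + 1) * d.Xi (n + 1)) * c := by simp only [mul_assoc]
          _ = b * d.X (n + 1) * (d.Ypi (n + 2) * c) := by rw [hX]; simp only [mul_assoc]
          _ = d.X (n + 1) * (b * c) * d.Ypi (n + 2) := by
            rw [d.A_X (by omega) hN (d.P_mem_A hb), ← d.A_Ypi (by omega) hN hcA]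
            simp only [mul_assoc]
          _ = _ := by rw [h]; simp only [mul_assoc]

theorem Dset_mul_P {n : ℕ} (hN : n < N) {k : ℕ} {b c : B} (hb : d.op.P n k (MulOpposite.op b))
    (hc : c ∈ d.Dset (n + 1)) : ∃ s ∈ d.S (n + 1), ∃ l ≤ k + 1, ∃ b',
      d.op.P (n + 1) l (MulOpposite.op b') ∧ c * b = b' * s := by
  obtain ⟨s, hs, l, hl, b', hb', h⟩ := d.op.P_mul_Cset hN hb (d.op_mem_Cset hc)
  exact ⟨s.unop, d.unop_mem_S hN hs, l, hl, b'.unop, hb', congrArg MulOpposite.unop h⟩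

/-- `d.F n v` means that `v = α * β * γ`, where `α` is a product of elements `Y'_i` and `γ` a
product of elements `(Y'_i)⁻¹` with at most `n` factors in total, and `β ∈ d.S n`. -/
def F (n : ℕ) (v : B) : Prop :=
  ∃ k l α β γ, d.op.P n k (MulOpposite.op α) ∧ β ∈ d.S n ∧ d.P n l γ ∧ k + l ≤ n ∧ v = α * β * γ

theorem F_mul_Cset {n : ℕ} (hN : n < N) {v c : B} (hv : d.F n v) (hc : c ∈ d.Cset (n + 1)) :
    d.F (n + 1) (v * c) := by
  obtain ⟨k, l, α, β, γ, hα, hβ, hγ, hkl, rfl⟩ := hv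
  obtain ⟨s, hs, l', hl', γ', hγ', h⟩ := d.P_mul_Cset hN hγ hc
  exact ⟨k, l', α, β * s, γ', hα.skip, mul_mem (d.S_mono (by omega) hβ) hs, hγ', by omega,
    by rw [mul_assoc, h]; simp only [mul_assoc]⟩

theorem Dset_mul_e_mul_F {n : ℕ} (hN : n < N) {v c : B} (hc : c ∈ d.Dset n) (hv : d.F n v) :
    d.F (n + 1) (c * d.e n * v) := by
  rcases n with _ | n
  · simp [Dset] at hc
  have he := d.e_mem_S (i := n + 1) (k := n + 2) (by omega) (by omega) hN
  have hSA : ∀ {s : B}, s ∈ d.S (n + 1) → s ∈ d.S (n + 2) := fun hs => d.S_mono (by omega) hs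
  obtain ⟨k, l, α, β, γ, hα, hβ, hγ, hkl, rfl⟩ := hv
  generalize ha : MulOpposite.op α = a at hα
  obtain rfl : α = a.unop := by rw [← ha]; rfl
  have hαA : ∀ {m : ℕ} {b : Bᵐᵒᵖ} {k : ℕ}, d.op.P m k b → b.unop ∈ d.A m := by
    intro m b k h
    have := d.op.P_mem_A h
    rw [op_A] at this
    exact this
  cases hα with
  | skip hα =>
    obtain ⟨s, hs, k', hk', α', hα', h⟩ := d.Dset_mul_P (b := a.unop) (by omega) hα hc
    refine ⟨k', l, α', s * d.e (n + 1) * β, γ, hα'.skip, mul_mem (mul_mem (hSA hs) he) (hSA hβ),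
      hγ.skip, by omega, ?_⟩
    calc _ = c * (d.e (n + 1) * a.unop) * β * γ := by simp only [mul_assoc]
      _ = c * a.unop * d.e (n + 1) * β * γ := by
        rw [← d.A_e (by omega) hN (hαA hα)]; simp only [mul_assoc]
      _ = _ := by rw [h]; simp only [mul_assoc]
  | @snoc _ k a hα =>
    obtain ⟨s, hs, k', hk', α', hα', h⟩ := d.Dset_mul_P (b := a.unop) (by omega) hα hc
    refine ⟨k', l + 1, α', s * (d.lam • d.e (n + 1)) * β, γ * d.Ypi (n + 2), hα'.skip,
      mul_mem (mul_mem (hSA hs) ((d.S _).smul_mem he _)) (hSA hβ), hγ.snoc, by omega, ?_⟩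
    rw [MulOpposite.unop_mul, op_Ypi, MulOpposite.unop_op]
    have hX := d.A_Ypi (k := n + 1) (j := n + 2) (by omega) hN (mul_mem (mul_mem
      (d.A_mono (by omega) (hαA hα)) (d.S_le_A _ hβ)) (d.P_mem_A hγ))
    calc _ = c * (d.e (n + 1) * d.Yp (n + 1)) * a.unop * β * γ := by simp only [mul_assoc]
      _ = c * (d.lam • d.e (n + 1)) * (d.Ypi (n + 2) * (a.unop * β * γ)) := by
        rw [d.e_Yp (by omega) hN]; simp only [mul_assoc, smul_mul_assoc, mul_smul_comm]
      _ = c * (d.lam • (d.e (n + 1) * a.unop)) * β * γ * d.Ypi (n + 2) := by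
        rw [← hX]; simp only [mul_assoc, smul_mul_assoc]
      _ = c * a.unop * (d.lam • d.e (n + 1)) * β * γ * d.Ypi (n + 2) := by
        rw [← d.A_e (by omega) hN (hαA hα)]
        simp only [mul_assoc, smul_mul_assoc, mul_smul_comm]
      _ = _ := by rw [h]; simp only [mul_assoc]

theorem F_of_mem_Bset {n : ℕ} (hN : n ≤ N) {v : B} (hv : v ∈ d.Bset n) : d.F n v := by
  induction n generalizing v with
  | zero =>
    rw [Bset, Finset.mem_singleton] at hv
    exact ⟨0, 0, 1, 1, 1, .one, one_mem _, .one, le_rfl, by simp [hv]⟩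
  | succ n ih =>
    simp only [Bset, Finset.mem_union, Finset.mem_mul, Finset.mem_singleton] at hv
    obtain ⟨s, hs, c, hc, rfl⟩ | ⟨_, ⟨c, hc, _, rfl, rfl⟩, s, hs, rfl⟩ := hv
    · exact d.F_mul_Cset hN (ih (by omega) hs) hc
    · exact d.Dset_mul_e_mul_F hN hc (ih (by omega) hs)

end Form

end Sys

section Presentation

open FreeAlgebra

variable {R : Type} [CommRing R] {lam lami del deli q0 q0i q1 A : R} {n : ℕ}

theorem mk_eq_of_rel {a b : FreeAlgebra R (Gen n)} (h : Rel R lam lami deli q0 q1 A n a b) :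
    mk R lam lami deli q0 q1 A n a = mk R lam lami deli q0 q1 A n b :=
  RingQuot.mkAlgHom_rel R h

theorem XX_of_lt {i : ℕ} (h : i - 1 < n - 1) : XX R lam lami deli q0 q1 A n i =
    mk R lam lami deli q0 q1 A n (fX R ⟨i - 1, h⟩) := dif_pos h

theorem XXi_of_lt {i : ℕ} (h : i - 1 < n - 1) : XXi R lam lami deli q0 q1 A n i =
    mk R lam lami deli q0 q1 A n (fXinv R ⟨i - 1, h⟩) := dif_pos h

theorem ee_of_lt {i : ℕ} (h : i - 1 < n - 1) : ee R lam lami deli q0 q1 A n i =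
    mk R lam lami deli q0 q1 A n (fe R deli ⟨i - 1, h⟩) := by
  simp only [ee, fe, XX_of_lt h, XXi_of_lt h, map_sub, map_smul, map_one]

theorem YY_of_pos (h : 0 < n) : YY R lam lami deli q0 q1 A n =
    mk R lam lami deli q0 q1 A n (fY R h) := dif_pos h

theorem YYi_of_pos (h : 0 < n) : YYi R lam lami deli q0 q1 A n =
    mk R lam lami deli q0 q1 A n (fYinv R h) := dif_pos h

theorem XX_mul_XXi (i : ℕ) :
    XX R lam lami deli q0 q1 A n i * XXi R lam lami deli q0 q1 A n i = 1 := by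
  by_cases h : i - 1 < n - 1
  · rw [XX_of_lt h, XXi_of_lt h, ← map_mul, mk_eq_of_rel (.XXinv _), map_one]
  · rw [XX, XXi, dif_neg h, dif_neg h, one_mul]

theorem XXi_mul_XX (i : ℕ) :
    XXi R lam lami deli q0 q1 A n i * XX R lam lami deli q0 q1 A n i = 1 := by
  by_cases h : i - 1 < n - 1
  · rw [XX_of_lt h, XXi_of_lt h, ← map_mul, mk_eq_of_rel (.XinvX _), map_one]
  · rw [XX, XXi, dif_neg h, dif_neg h, one_mul]

theorem YY_mul_YYi (hn : 0 < n) :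
    YY R lam lami deli q0 q1 A n * YYi R lam lami deli q0 q1 A n = 1 := by
  rw [YY_of_pos hn, YYi_of_pos hn, ← map_mul, mk_eq_of_rel (.YYinv _), map_one]

theorem YYi_mul_YY (hn : 0 < n) :
    YYi R lam lami deli q0 q1 A n * YY R lam lami deli q0 q1 A n = 1 := by
  rw [YY_of_pos hn, YYi_of_pos hn, ← map_mul, mk_eq_of_rel (.YinvY _), map_one]

theorem YY_eq (hn : 0 < n) : YY R lam lami deli q0 q1 A n =
    q1 • (1 : BB R lam lami deli q0 q1 A n) + q0 • YYi R lam lami deli q0 q1 A n := by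
  have h : YY R lam lami deli q0 q1 A n * YY R lam lami deli q0 q1 A n =
      q1 • YY R lam lami deli q0 q1 A n + q0 • 1 := by
    rw [YY_of_pos hn, ← map_mul, mk_eq_of_rel (.Ysq _), map_add, map_smul, map_smul, map_one]
  have h' := congrArg (· * YYi R lam lami deli q0 q1 A n) h
  simpa only [mul_assoc, YY_mul_YYi hn, mul_one, add_mul, smul_mul_assoc, one_mul] using h'

/-- The generators of `BB_n(R)` satisfy the relations of the type B BMW algebra. -/
noncomputable def sys (hlam : lam * lami = 1) (hdel : del * deli = 1) (hq0u : q0 * q0i = 1)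
    (hn : 0 < n) : Sys R (BB R lam lami deli q0 q1 A n) n where
  X := XX R lam lami deli q0 q1 A n
  Xi := XXi R lam lami deli q0 q1 A n
  e := ee R lam lami deli q0 q1 A n
  Y := YY R lam lami deli q0 q1 A n
  Yi := YYi R lam lami deli q0 q1 A n
  lam := lam
  lami := lami
  del := del
  deli := deli
  lam_mul := hlam
  del_mul := hdel
  X_mul_Xi := XX_mul_XXi
  Xi_mul_X := XXi_mul_XX
  Y_mul_Yi := YY_mul_YYi hn
  Yi_mul_Y := YYi_mul_YY hn
  Xi_eq i := by
    rw [ee, smul_sub, smul_smul, hdel, one_smul]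
    abel
  X_comm i j hi hij hj := by
    rw [XX_of_lt (show i - 1 < n - 1 by omega), XX_of_lt (show j - 1 < n - 1 by omega),
      ← map_mul, ← map_mul]
    exact (mk_eq_of_rel (.comm _ _ (show i - 1 + 1 < j - 1 by omega))).symm
  braid i hi hj := by
    rw [XX_of_lt (show i - 1 < n - 1 by omega), XX_of_lt (show i + 1 - 1 < n - 1 by omega),
      ← map_mul, ← map_mul, ← map_mul, ← map_mul]
    exact mk_eq_of_rel (.braid _ _ (show i - 1 + 1 = i + 1 - 1 by omega))
  X_e i hi hj := by
    have h : i - 1 < n - 1 := by omega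
    rw [XX_of_lt h, ee_of_lt h, ← map_mul, ← map_smul]
    exact mk_eq_of_rel (.Xe _)
  e_X i hi hj := by
    have h : i - 1 < n - 1 := by omega
    rw [XX_of_lt h, ee_of_lt h, ← map_mul, ← map_smul]
    exact mk_eq_of_rel (.eX _)
  e_X_e i hi hj := by
    rw [XX_of_lt (show i - 1 < n - 1 by omega), ee_of_lt (show i + 1 - 1 < n - 1 by omega),
      ← map_mul, ← map_mul, ← map_smul]
    exact mk_eq_of_rel (.eXe _ _ (show i - 1 + 1 = i + 1 - 1 by omega))
  e_Xi_e i hi hj := by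
    rw [XXi_of_lt (show i - 1 < n - 1 by omega), ee_of_lt (show i + 1 - 1 < n - 1 by omega),
      ← map_mul, ← map_mul, ← map_smul]
    exact mk_eq_of_rel (.eXinve _ _ (show i - 1 + 1 = i + 1 - 1 by omega))
  Y_X i hi hj := by
    rw [XX_of_lt (show i - 1 < n - 1 by omega), YY_of_pos hn, ← map_mul, ← map_mul]
    exact mk_eq_of_rel (.Ycomm _ _ (show 0 < i - 1 by omega))
  YXYX h := by
    rw [XX_of_lt (show 1 - 1 < n - 1 by omega), YY_of_pos hn, ← map_mul, ← map_mul, ← map_mul,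
      ← map_mul, ← map_mul, ← map_mul]
    exact mk_eq_of_rel (.bYXYX _ _ rfl)
  YXY_e h := by
    have h : 1 - 1 < n - 1 := by omega
    rw [XX_of_lt h, ee_of_lt h, YY_of_pos hn, ← map_mul, ← map_mul, ← map_mul]
    exact mk_eq_of_rel (.YXYe _ _ rfl)
  Y_mem := ⟨q1, q0, YY_eq hn⟩
  Yi_mem := by
    refine ⟨-(q0i * q1), q0i, ?_⟩
    conv_rhs => rw [YY_eq hn]
    rw [smul_add, smul_smul, smul_smul, mul_comm q0i q0, hq0u, one_smul, ← add_assoc,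
      ← add_smul, neg_add_cancel, zero_smul, zero_add]
  e_Y_e h := by
    have h : 1 - 1 < n - 1 := by omega
    refine ⟨A, ?_⟩
    rw [ee_of_lt h, YY_of_pos hn, ← map_mul, ← map_mul, ← map_smul]
    exact mk_eq_of_rel (.eYe _ _ rfl)

theorem sys_A_eq_top (hlam : lam * lami = 1) (hdel : del * deli = 1) (hq0u : q0 * q0i = 1)
    (hn : 0 < n) : (sys (q1 := q1) (A := A) hlam hdel hq0u hn).A n = ⊤ := by
  set d := sys (q1 := q1) (A := A) hlam hdel hq0u hn
  rw [eq_top_iff]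
  rintro b -
  obtain ⟨b, rfl⟩ := RingQuot.mkAlgHom_surjective R (Rel R lam lami deli q0 q1 A n) b
  induction b using FreeAlgebra.induction with
  | grade0 r => rw [AlgHom.commutes]; exact (d.A n).algebraMap_mem r
  | grade1 g =>
    rcases g with i | i | h | h
    · have hi : (i : ℕ) + 1 - 1 < n - 1 := i.2
      have : d.X (i + 1) = mk R lam lami deli q0 q1 A n (fX R i) := XX_of_lt hi
      exact this ▸ d.X_mem_A (by omega) (by omega)
    · have hi : (i : ℕ) + 1 - 1 < n - 1 := i.2
      have : d.Xi (i + 1) = mk R lam lami deli q0 q1 A n (fXinv R i) := XXi_of_lt hi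
      exact this ▸ d.Xi_mem_A (by omega) (by omega)
    · have : d.Y = mk R lam lami deli q0 q1 A n (fY R h) := YY_of_pos h
      exact this ▸ d.Yp_mem_A (j := 1) hn
    · have : d.Yi = mk R lam lami deli q0 q1 A n (fYinv R h) := YYi_of_pos h
      exact this ▸ d.Ypi_mem_A (j := 1) hn
  | mul a b ha hb => rw [map_mul]; exact mul_mem ha hb
  | add a b ha hb => rw [map_add]; exact add_mem ha hb

theorem sys_Yp (hlam : lam * lami = 1) (hdel : del * deli = 1) (hq0u : q0 * q0i = 1)
    (hn : 0 < n) : ∀ k, (sys (q1 := q1) (A := A) hlam hdel hq0u hn).Yp k =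
      Yp R lam lami deli q0 q1 A n k
  | 0 => rfl
  | 1 => rfl
  | (k + 2) => by rw [Sys.Yp, Yp, sys_Yp hlam hdel hq0u hn (k + 1)]; rfl

theorem sys_Ypi (hlam : lam * lami = 1) (hdel : del * deli = 1) (hq0u : q0 * q0i = 1)
    (hn : 0 < n) : ∀ k, (sys (q1 := q1) (A := A) hlam hdel hq0u hn).Ypi k =
      Ypi R lam lami deli q0 q1 A n k
  | 0 => rfl
  | 1 => rfl
  | (k + 2) => by rw [Sys.Ypi, Ypi, sys_Ypi hlam hdel hq0u hn (k + 1)]; rfl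

end Presentation

/-- Proposition 11 (dimension bound): `BB_n(R)` is spanned by at most `2^n (2n−1)!!` elements
of the form `α β γ` with `α` a product of `Y'`-s, `γ` a product of `Y'⁻¹`-s (at most `n`
factors in total) and `β` in the subalgebra generated by `X_1, …, X_{n−1}`; in particular
over a field the dimension is at most `2^n (2n−1)!!`. -/
theorem BB_dimension_bound (R : Type) [CommRing R] [IsDomain R]
    (q qi lam lami del deli q0 q0i q1 A x : R)
    (hq : q * qi = 1) (hlam : lam * lami = 1) (hdel : del * deli = 1) (hq0u : q0 * q0i = 1)
    (hdelta : del = q - qi) (hx : x * del = del - lam + lami)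
    (hA : A * (1 - q0 * lam) = q1 * x) (hq0 : q0 = qi) (n : ℕ) (hn : 1 ≤ n) :
    (∃ s : Finset (BB R lam lami deli q0 q1 A n),
      s.card ≤ 2 ^ n * Nat.doubleFactorial (2 * n - 1) ∧
      (∀ v ∈ s, ∃ (L1 L2 : List ℕ) (β : BB R lam lami deli q0 q1 A n),
        (∀ i ∈ L1, 1 ≤ i ∧ i ≤ n) ∧ (∀ i ∈ L2, 1 ≤ i ∧ i ≤ n) ∧
        L1.length + L2.length ≤ n ∧
        β ∈ Algebra.adjoin R {a : BB R lam lami deli q0 q1 A n | ∃ i, 1 ≤ i ∧ i ≤ n - 1 ∧ a = XX R lam lami deli q0 q1 A n i} ∧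
        v = (L1.map (Yp R lam lami deli q0 q1 A n)).prod * β * (L2.map (Ypi R lam lami deli q0 q1 A n)).prod) ∧
      Submodule.span R (s : Set (BB R lam lami deli q0 q1 A n)) = ⊤) ∧
    (IsField R → Module.rank R (BB R lam lami deli q0 q1 A n) ≤ ((2 ^ n * Nat.doubleFactorial (2 * n - 1) : ℕ) : Cardinal)) := by
  have hspan : ∃ s : Finset (BB R lam lami deli q0 q1 A n),
      s.card ≤ 2 ^ n * Nat.doubleFactorial (2 * n - 1) ∧
      (∀ v ∈ s, (sys (q1 := q1) (A := A) hlam hdel hq0u hn).F n v) ∧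
      Submodule.span R (s : Set (BB R lam lami deli q0 q1 A n)) = ⊤ := by
    refine ⟨Sys.Bset _ n, Sys.card_Bset_le _ n, fun v hv => Sys.F_of_mem_Bset _ le_rfl hv, ?_⟩
    rw [eq_top_iff, ← Algebra.top_toSubmodule, ← sys_A_eq_top hlam hdel hq0u hn]
    exact Sys.M_le_span _ n le_rfl
  obtain ⟨s, hcard, hF, hs⟩ := hspan
  refine ⟨⟨s, hcard, fun v hv => ?_, hs⟩, fun _ => ?_⟩
  · obtain ⟨k, l, α, β, γ, hα, hβ, hγ, hkl, rfl⟩ := hF v hv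
    obtain ⟨L1, h1, rfl, hL1⟩ := Sys.exists_list_of_P _ hα
    obtain ⟨L2, h2, rfl, hL2⟩ := Sys.exists_list_of_P _ hγ
    refine ⟨L1.reverse, L2, β, by simpa using h1, h2, by simpa using hkl, ?_, ?_⟩
    · refine Algebra.adjoin_mono ?_ hβ
      rintro _ ⟨i, hi, hi', rfl⟩
      exact ⟨i, hi, by omega, rfl⟩
    · have hα : α = (L1.reverse.map (Yp R lam lami deli q0 q1 A n)).prod := by
        have := congrArg MulOpposite.unop hL1
        rw [MulOpposite.unop_op, MulOpposite.unop_list_prod, List.map_map, ← List.map_reverse]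
          at this
        rw [this]
        congr 2
        funext i
        rw [Function.comp_apply, Sys.op_Ypi, MulOpposite.unop_op, sys_Yp]
      rw [hα, hL2, show Sys.Ypi _ = _ from funext (sys_Ypi hlam hdel hq0u hn)]
  · rw [← rank_top, ← hs]
    exact (rank_span_finset_le s).trans (by exact_mod_cast hcard)

end BMWB
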